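/- arXiv:math/0209398 — 2 statements merged into one kernel-verified Lean document; each statement's English description precedes it below -/
import Mathlib

section
/- Define B_1, B_2 as follows for strictly increasing l-tuples b, c of positive integers (l ≥ 2): B_1(b;c) = ∑_{d ∈ S_l} A(d;c) {d; b} (1-t)^{∑(c_i - d_i)} and B_2(b;c) = ∑_{d ∈ S_l} A(b;d) [c; d] (1-t)^{∑(d_i - b_i)}. Then B_1(b;c) = B_2(b;c) for all l ≥ 2 and all b, c ∈ S_l. -/
open Polynomial Finset

/-- Bracket symbol: `t` if `c > b`, `1` if `c = b`, `0` if `c < b` (here `t = X ∈ ℚ[t]`). -/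
noncomputable def brk (c b : ℕ) : Polynomial ℚ :=
  if b < c then X else if c = b then 1 else 0

/-- Tuple bracket: `0` if `c i ≥ b (i+1)` for some `i < l`, and `∏ᵢ [cᵢ, bᵢ]` otherwise. -/
noncomputable def brkT {l : ℕ} (c b : Fin l → ℕ) : Polynomial ℚ :=
  if ∀ i : Fin l, ∀ h : (i : ℕ) + 1 < l, c i < b ⟨(i : ℕ) + 1, h⟩ then
    ∏ i, brk (c i) (b i)
  else 0

/-- Antisymmetrized tuple bracket `{c; b} = ∑_σ sign(σ) ∏ᵢ [c_{σ(i)}, bᵢ]`. -/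
noncomputable def braceT {l : ℕ} (c b : Fin l → ℕ) : Polynomial ℚ :=
  ∑ σ : Equiv.Perm (Fin l), (Equiv.Perm.sign σ : ℤ) • ∏ i, brk (c (σ i)) (b i)

/-- The recursively defined coefficient `A(b; c)`:  for `l = 2`, `A = 1` iff `b₂ = c₂` and
`b₁ ≤ c₁`; for `l > 2`, `A(b;c) = 0` if the last entries differ, and otherwise it is the sum
of `A` on the truncations over all strictly increasing `(l-1)`-tuples `c'` of positive
integers with `c' ≤ (c₁, …, c_{l-1})` componentwise. -/
def Acoef : (l : ℕ) → (Fin l → ℕ) → (Fin l → ℕ) → ℕ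
  | 0, _, _ => 0
  | 1, _, _ => 0
  | 2, b, c => if b 1 = c 1 ∧ b 0 ≤ c 0 then 1 else 0
  | l + 3, b, c =>
    if b (Fin.last (l + 2)) = c (Fin.last (l + 2)) then
      ∑ c' ∈ (Finset.Icc (fun _ => 1) (fun j : Fin (l + 2) => c j.castSucc)).filter
          (fun c' => ∀ i j : Fin (l + 2), i < j → c' i < c' j),
        Acoef (l + 2) (fun j => b j.castSucc) c'
    else 0


section Abstract
variable {R : Type*} [CommRing R]

theorem det_sum_rows {m : ℕ} (A : Fin m → Finset ℕ) (g : Fin m → ℕ → Fin m → R) :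
    Matrix.det (Matrix.of fun i j => ∑ z ∈ A i, g i z j) =
      ∑ r ∈ Fintype.piFinset A, Matrix.det (Matrix.of fun i j => g i (r i) j) := by
  have h := MultilinearMap.map_sum_finset
    (Matrix.detRowAlternating (n := Fin m) (R := R)).toMultilinearMap g A
  have e : (Matrix.of fun i j => ∑ z ∈ A i, g i z j) = fun i => ∑ z ∈ A i, g i z := by
    ext i j
    simp [Finset.sum_apply]
  rw [e]
  exact h

theorem cancel_fiber {m : ℕ} (g : Fin m → ℕ → Fin m → R) (s : Fin m → ℕ) (p q : Fin m)
    (hpq : p ≠ q) (a : R)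
    (h : ∀ j, ∑ z ∈ Finset.Icc 1 (s p), g q z j = a * g p (s p) j) :
    ∑ z ∈ Finset.Icc 1 (s p),
      Matrix.det (Matrix.of fun i j => g i (Function.update s q z i) j) = 0 := by
  set M : Matrix (Fin m) (Fin m) R := Matrix.of fun i j => g i (s i) j with hM
  have e : ∀ z, (Matrix.of fun i j => g i (Function.update s q z i) j) =
      M.updateRow q (g q z) := by
    intro z
    ext i j
    by_cases hi : i = q
    · subst hi; simp
    · simp [hi, hM]
  simp_rw [e]
  have h2 : ∑ z ∈ Finset.Icc 1 (s p), Matrix.det (M.updateRow q (g q z)) =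
      Matrix.det (M.updateRow q (∑ z ∈ Finset.Icc 1 (s p), g q z)) := by
    have := (MultilinearMap.map_update_sum
      (Matrix.detRowAlternating (n := Fin m) (R := R)).toMultilinearMap
      (Finset.Icc 1 (s p)) q (g q) M)
    exact this.symm
  rw [h2]
  have h3 : (∑ z ∈ Finset.Icc 1 (s p), g q z) = a • g p (s p) := by
    ext j
    simp [Finset.sum_apply, h]
  rw [h3, Matrix.det_updateRow_smul]
  rw [Matrix.det_zero_of_row_eq hpq, mul_zero]
  ext j
  simp [hpq, hM]

open Classical in
theorem cancel_step {m : ℕ} (g : Fin m → ℕ → Fin m → R) (c : Fin m → ℕ) (hc : StrictMono c)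
    (k : ℕ) (hk : k + 1 < m)
    (h : ∀ x, 1 ≤ x → x ≤ c ⟨k, by omega⟩ → ∃ a : R, ∀ j,
      ∑ z ∈ Finset.Icc 1 x, g ⟨k + 1, hk⟩ z j = a * g ⟨k, by omega⟩ x j) :
    ∑ r ∈ (Fintype.piFinset fun i => Finset.Icc 1 (c i)).filter (fun r =>
        (∀ i (hi : i + 1 < m), i < k → r ⟨i, by omega⟩ < r ⟨i + 1, hi⟩) ∧
          r ⟨k + 1, hk⟩ ≤ r ⟨k, by omega⟩),
      Matrix.det (Matrix.of fun i j => g i (r i) j) = 0 := by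
  set S := (Fintype.piFinset fun i => Finset.Icc 1 (c i)).filter (fun r =>
        (∀ i (hi : i + 1 < m), i < k → r ⟨i, by omega⟩ < r ⟨i + 1, hi⟩) ∧
          r ⟨k + 1, hk⟩ ≤ r ⟨k, by omega⟩) with hS
  set p : Fin m := ⟨k, by omega⟩ with hp
  set q : Fin m := ⟨k + 1, hk⟩ with hq
  have hpq : p ≠ q := by simp [hp, hq]
  have hlt : p < q := by simp [hp, hq]
  rw [← Finset.sum_fiberwise_of_maps_to (s := S) (t := S.image fun r => Function.update r q 1)
    (g := fun r => Function.update r q 1) (fun x hx => Finset.mem_image_of_mem _ hx)]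
  apply Finset.sum_eq_zero
  intro y hy
  obtain ⟨s, hs, rfl⟩ := Finset.mem_image.1 hy
  have hs' := hs
  simp only [hS, Finset.mem_filter, Fintype.mem_piFinset, Finset.mem_Icc] at hs'
  obtain ⟨hbox, hF, hle⟩ := hs'
  have hset : S.filter (fun r => Function.update r q 1 = Function.update s q 1) =
      (Finset.Icc 1 (s p)).image (fun z => Function.update s q z) := by
    ext r
    simp only [Finset.mem_filter, Finset.mem_image, Finset.mem_Icc]
    constructor
    · rintro ⟨hr, hru⟩
      simp only [hS, Finset.mem_filter, Fintype.mem_piFinset, Finset.mem_Icc] at hr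
      have hne : ∀ i, i ≠ q → r i = s i := by
        intro i hi
        have := congrFun hru i
        simpa [hi] using this
      refine ⟨r q, ⟨(hr.1 q).1, ?_⟩, ?_⟩
      · rw [← hne p hpq]; exact hr.2.2
      · ext i
        by_cases hi : i = q
        · subst hi; simp
        · simp [hi, hne i hi]
    · rintro ⟨z, ⟨hz1, hz2⟩, rfl⟩
      refine ⟨?_, by simp⟩
      simp only [hS, Finset.mem_filter, Fintype.mem_piFinset, Finset.mem_Icc]
      refine ⟨?_, ?_, ?_⟩
      · intro i
        by_cases hi : i = q
        · subst hi
          have := hc hlt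
          have := (hbox p).2
          simp; omega
        · simpa [hi] using hbox i
      · intro i hi hik
        have h1 : (⟨i, by omega⟩ : Fin m) ≠ q := by simp [hq]; omega
        have h2 : (⟨i + 1, hi⟩ : Fin m) ≠ q := by simp [hq]; omega
        simpa [h1, h2] using hF i hi hik
      · rw [Function.update_self, Function.update_of_ne hpq]
        exact hz2
  rw [hset, Finset.sum_image]
  · obtain ⟨a, ha⟩ := h (s p) (hbox p).1 (hbox p).2
    exact cancel_fiber g s p q hpq a ha
  · intro z _ z' _ hzz
    have := congrFun hzz q
    simpa using this

theorem cancel_all {m : ℕ} (g : Fin m → ℕ → Fin m → R) (c : Fin m → ℕ) (hc : StrictMono c)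
    (h : ∀ (k : ℕ) (hk : k + 1 < m), ∀ x, 1 ≤ x → x ≤ c ⟨k, by omega⟩ → ∃ a : R, ∀ j,
      ∑ z ∈ Finset.Icc 1 x, g ⟨k + 1, hk⟩ z j = a * g ⟨k, by omega⟩ x j) :
    ∑ r ∈ (Finset.Icc (fun _ => 1) c).filter (fun r => ∀ i j, i < j → r i < r j),
      Matrix.det (Matrix.of fun i j => g i (r i) j) =
    Matrix.det (Matrix.of fun i j => ∑ z ∈ Finset.Icc 1 (c i), g i z j) := by
  classical
  rw [det_sum_rows]
  have key : ∀ k : ℕ, ∑ r ∈ (Fintype.piFinset fun i => Finset.Icc 1 (c i)).filter (fun r =>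
        (∀ i (hi : i + 1 < m), i < k → r ⟨i, by omega⟩ < r ⟨i + 1, hi⟩)),
      Matrix.det (Matrix.of fun i j => g i (r i) j) =
      ∑ r ∈ Fintype.piFinset (fun i => Finset.Icc 1 (c i)),
        Matrix.det (Matrix.of fun i j => g i (r i) j) := by
    intro k
    induction k with
    | zero => simp
    | succ k ih =>
      rw [← ih]
      by_cases hk : k + 1 < m
      · have h0 := cancel_step g c hc k hk (h k hk)
        conv_rhs => rw [← Finset.sum_filter_add_sum_filter_not (Finset.filter _ _)
          (fun r => r ⟨k + 1, hk⟩ ≤ r ⟨k, by omega⟩), Finset.filter_filter, h0, zero_add,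
          Finset.filter_filter]
        apply Finset.sum_congr _ (fun _ _ => rfl)
        apply Finset.filter_congr
        intro r _
        constructor
        · intro H
          exact ⟨fun i hi hik => H i hi (by omega), by have := H k hk (by omega); omega⟩
        · rintro ⟨H, H2⟩ i hi hik
          rcases Nat.lt_succ_iff_lt_or_eq.1 hik with h1 | h1
          · exact H i hi h1
          · subst h1; omega
      · apply Finset.sum_congr _ (fun _ _ => rfl)
        apply Finset.filter_congr
        intro r _
        constructor
        · intro H i hi hik
          exact H i hi (by omega)
        · intro H i hi hik
          exact H i hi (by omega)
  rw [← key m, Pi.Icc_eq]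
  apply Finset.sum_congr _ (fun _ _ => rfl)
  apply Finset.filter_congr
  intro r _
  constructor
  · intro H i hi _
    exact H _ _ (by simp)
  · intro H
    have : StrictMono r := by
      cases m with
      | zero => intro i; exact i.elim0
      | succ m =>
        rw [Fin.strictMono_iff_lt_succ]
        intro i
        exact H i (by omega) (by omega)
    exact fun i j hij => this hij

/-- Cauchy–Binet -/
theorem cauchy_binet' {m : ℕ} (N : ℕ) (M : Fin m → ℕ → R) (B : ℕ → Fin m → R) :
    ∑ d ∈ (Finset.Icc (fun _ => 1) (fun _ : Fin m => N)).filter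
        (fun r => ∀ i j, i < j → r i < r j),
      Matrix.det (Matrix.of fun i j => M i (d j)) * Matrix.det (Matrix.of fun i j => B (d i) j) =
    Matrix.det (Matrix.of fun i j => ∑ z ∈ Finset.Icc 1 N, M i z * B z j) := by
  rw [det_sum_rows (fun _ => Finset.Icc 1 N) (fun i z j => M i z * B z j)]
  have e1 : ∀ r : Fin m → ℕ, Matrix.det (Matrix.of fun i j => M i (r i) * B (r i) j) =
      (∏ i, M i (r i)) * Matrix.det (Matrix.of fun i j => B (r i) j) := by
    intro r
    exact Matrix.det_mul_column (fun i => M i (r i)) (Matrix.of fun i j => B (r i) j)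
  simp_rw [e1]
  have e2 : ∀ d : Fin m → ℕ,
      Matrix.det (Matrix.of fun i j => M i (d j)) * Matrix.det (Matrix.of fun i j => B (d i) j) =
      ∑ σ : Equiv.Perm (Fin m), (∏ i, M i (d (σ i))) *
        Matrix.det (Matrix.of fun i j => B (d (σ i)) j) := by
    intro d
    rw [← Matrix.det_transpose, Matrix.det_apply, Finset.sum_mul]
    apply Finset.sum_congr rfl
    intro σ _
    have := Matrix.det_permute σ (Matrix.of fun i j => B (d i) j)
    have e3 : (Matrix.of fun i j => B (d (σ i)) j) =
      (Matrix.of fun i j => B (d i) j).submatrix σ id := by ext i j; simp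
    rw [e3, this]
    simp only [Matrix.transpose_apply, Matrix.of_apply, Units.smul_def, zsmul_eq_mul]
    ring
  simp_rw [e2]
  rw [← Finset.sum_product']
  have e4 : ∑ r ∈ Fintype.piFinset (fun _ : Fin m => Finset.Icc 1 N),
      (∏ i, M i (r i)) * Matrix.det (Matrix.of fun i j => B (r i) j) =
      ∑ r ∈ (Fintype.piFinset (fun _ : Fin m => Finset.Icc 1 N)).filter Function.Injective,
      (∏ i, M i (r i)) * Matrix.det (Matrix.of fun i j => B (r i) j) := by
    symm
    apply Finset.sum_subset (Finset.filter_subset _ _)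
    intro r hr hr2
    have : ¬ Function.Injective r := fun hh => hr2 (Finset.mem_filter.2 ⟨hr, hh⟩)
    simp only [Function.Injective, not_forall] at this
    obtain ⟨i, j, hij, hne⟩ := this
    rw [Matrix.det_zero_of_row_eq hne, mul_zero]
    ext k
    simp [hij]
  rw [e4]
  apply Finset.sum_bij (fun (x : (Fin m → ℕ) × Equiv.Perm (Fin m)) _ => x.1 ∘ x.2)
  · rintro ⟨d, σ⟩ hx
    simp only [Finset.mem_product, Finset.mem_filter, Finset.mem_univ, and_true, Pi.Icc_eq,
      Fintype.mem_piFinset] at hx ⊢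
    have hd : StrictMono d := fun i j hij => hx.2 i j hij
    exact ⟨fun i => hx.1 (σ i), hd.injective.comp σ.injective⟩
  · rintro ⟨d, σ⟩ hx ⟨d', σ'⟩ hx' he
    simp only [Finset.mem_product, Finset.mem_filter, Finset.mem_univ, and_true] at hx hx' he
    have hd : StrictMono d := fun i j hij => hx.2 i j hij
    have hd' : StrictMono d' := fun i j hij => hx'.2 i j hij
    have hr : Set.range d = Set.range d' := by
      have := congrArg Set.range he
      rwa [σ.surjective.range_comp, σ'.surjective.range_comp] at this
    have hdd : d = d' := (StrictMono.range_inj hd hd').1 hr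
    subst hdd
    congr 1
    ext i
    have := hd.injective (congrFun he i)
    rw [this]
  · intro r hr
    simp only [Finset.mem_filter, Fintype.mem_piFinset] at hr
    refine ⟨(r ∘ Tuple.sort r, (Tuple.sort r)⁻¹), ?_, ?_⟩
    · simp only [Finset.mem_product, Finset.mem_filter, Finset.mem_univ, and_true, Pi.Icc_eq,
        Fintype.mem_piFinset]
      have := (Tuple.monotone_sort r).strictMono_of_injective
        (hr.2.comp (Tuple.sort r).injective)
      exact ⟨fun i => hr.1 _, fun i j hij => this hij⟩
    · ext i
      simp
  · rintro ⟨d, σ⟩ hx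
    rfl

end Abstract

/-- Weighted path kernel. -/
noncomputable def Kp : ℕ → ℕ → ℕ → Polynomial ℚ
  | 0, x, y => if x = y then 1 else 0
  | m + 1, x, y => ∑ z ∈ Finset.Icc 1 x, (1 - X) ^ (x - z) * Kp m z y

/-- Product kernel. -/
noncomputable def Lp : ℕ → ℕ → ℕ → Polynomial ℚ
  | 0, x, y => brk x y
  | m + 1, x, y => ∑ z ∈ Finset.Icc 1 x, (1 - X) ^ (x - z) * Lp m z y

theorem Kp_succ (m x y : ℕ) :
    Kp (m + 1) x y = ∑ z ∈ Finset.Icc 1 x, (1 - X) ^ (x - z) * Kp m z y := by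
  rw [Kp]

theorem Lp_succ (m x y : ℕ) :
    Lp (m + 1) x y = ∑ z ∈ Finset.Icc 1 x, (1 - X) ^ (x - z) * Lp m z y := by
  rw [Lp]

theorem Kp_eq_zero (m x y : ℕ) (h : x < y) : Kp m x y = 0 := by
  induction m generalizing x with
  | zero => simp [Kp, h.ne]
  | succ m ih =>
    rw [Kp_succ]
    apply Finset.sum_eq_zero
    intro z hz
    rw [ih z (by have := Finset.mem_Icc.1 hz; omega), mul_zero]

theorem P_succ (f : ℕ → Polynomial ℚ) (x : ℕ) :
    ∑ z ∈ Finset.Icc 1 (x + 1), (1 - X) ^ (x + 1 - z) * f z =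
      (1 - X) * (∑ z ∈ Finset.Icc 1 x, (1 - X) ^ (x - z) * f z) + f (x + 1) := by
  rw [Finset.sum_Icc_succ_top (by omega), Finset.mul_sum]
  congr 1
  · apply Finset.sum_congr rfl
    intro z hz
    have := Finset.mem_Icc.1 hz
    rw [show x + 1 - z = (x - z) + 1 by omega, pow_succ]
    ring
  · simp

theorem PH_rel (f : ℕ → Polynomial ℚ) (x : ℕ) :
    X * (∑ z ∈ Finset.Icc 1 x, (1 - X) ^ (x - z) * ∑ w ∈ Finset.Icc 1 z, f w) +
      (1 - X) * (∑ z ∈ Finset.Icc 1 x, (1 - X) ^ (x - z) * f z) =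
    ∑ z ∈ Finset.Icc 1 x, f z := by
  induction x with
  | zero => simp
  | succ x ih =>
    rw [P_succ, P_succ, Finset.sum_Icc_succ_top (by omega)]
    linear_combination (1 - X) * ih

theorem PH_comm (f : ℕ → Polynomial ℚ) (x : ℕ) :
    ∑ z ∈ Finset.Icc 1 x, (1 - X) ^ (x - z) * ∑ w ∈ Finset.Icc 1 z, f w =
    ∑ z ∈ Finset.Icc 1 x, ∑ w ∈ Finset.Icc 1 z, (1 - X) ^ (z - w) * f w := by
  induction x with
  | zero => simp
  | succ x ih =>
    rw [P_succ, Finset.sum_Icc_succ_top (by omega : 1 ≤ x + 1) f,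
      Finset.sum_Icc_succ_top (by omega), P_succ, ← ih]
    linear_combination - PH_rel f x

theorem Lp_eq (m x y : ℕ) (hy : 1 ≤ y) :
    Lp (m + 1) x y = ∑ z ∈ Finset.Icc 1 x, Kp m z y := by
  induction m generalizing x with
  | zero =>
    induction x with
    | zero => simp [Lp_succ]
    | succ x ih =>
      rw [Lp_succ, P_succ, ← Lp_succ, ih, Finset.sum_Icc_succ_top (by omega)]
      simp only [Kp, Lp, brk, Finset.sum_ite_eq', Finset.mem_Icc]
      rcases lt_trichotomy y (x + 1) with h | h | h
      · rw [if_pos (by omega), if_pos h, if_neg (by omega)]; ring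
      · rw [if_neg (by omega), if_neg (by omega), if_pos (by omega)]; ring
      · rw [if_neg (by omega), if_neg (by omega), if_neg (by omega)]; ring
  | succ m ih =>
    rw [Lp_succ]
    simp_rw [ih, Kp_succ]
    exact PH_comm _ _

theorem Lp_sum (m x y N : ℕ) (hx : 1 ≤ x) (hxN : x ≤ N) :
    ∑ z ∈ Finset.Icc 1 N, Kp m x z * brk z y = Lp m x y := by
  induction m generalizing x with
  | zero =>
    simp only [Kp, Lp, ite_mul, one_mul, zero_mul, Finset.sum_ite_eq, Finset.mem_Icc]
    rw [if_pos ⟨hx, hxN⟩]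
  | succ m ih =>
    rw [Lp_succ]
    simp_rw [Kp_succ, Finset.sum_mul]
    rw [Finset.sum_comm]
    apply Finset.sum_congr rfl
    intro w hw
    have := Finset.mem_Icc.1 hw
    rw [← ih w (by omega) (by omega), Finset.mul_sum]
    apply Finset.sum_congr rfl
    intros; ring

theorem brk_sum (f : ℕ → Polynomial ℚ) (x : ℕ) (hx : 1 ≤ x) :
    ∑ z ∈ Finset.Icc 1 x, brk x z * f z = X * ∑ z ∈ Finset.Icc 1 x, f z + (1 - X) * f x := by
  obtain ⟨x, rfl⟩ : ∃ k, x = k + 1 := ⟨x - 1, by omega⟩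
  rw [Finset.sum_Icc_succ_top (by omega), Finset.sum_Icc_succ_top (by omega)]
  have : ∑ z ∈ Finset.Icc 1 x, brk (x + 1) z * f z = X * ∑ z ∈ Finset.Icc 1 x, f z := by
    rw [Finset.mul_sum]
    apply Finset.sum_congr rfl
    intro z hz
    have := Finset.mem_Icc.1 hz
    rw [brk, if_pos (by omega)]
  rw [this]
  simp [brk]
  ring

theorem brk_K (m x y : ℕ) (hx : 1 ≤ x) (hy : 1 ≤ y) :
    ∑ z ∈ Finset.Icc 1 x, brk x z * Kp m z y = Lp m x y := by
  rw [brk_sum _ _ hx]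
  cases m with
  | zero =>
    simp only [Kp, Lp, brk, Finset.sum_ite_eq', Finset.mem_Icc]
    rcases lt_trichotomy y x with h | h | h
    · rw [if_pos (by omega), if_pos h, if_neg (by omega)]; ring
    · subst h; simp [hx]
    · rw [if_neg (by omega), if_neg (by omega), if_neg (by omega)]; simp
  | succ m =>
    rw [Lp_eq m x y hy, ← PH_rel (fun z => Kp m z y) x]
    simp_rw [Kp_succ]
    rw [PH_comm]

/-- the row of `B₂` -/
theorem brk_row (m x y p : ℕ) (hx : p < x) (hy : 1 ≤ y) :
    ∑ z ∈ Finset.Ioc p x, brk x z * Kp m z y = Lp m x y - X * Lp (m + 1) p y := by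
  rw [← brk_K m x y (by omega) hy, Lp_eq m p y hy]
  have h1 : ∀ a, Finset.Icc 1 a = Finset.Ioc 0 a := by intro a; ext; simp; omega
  rw [h1, h1, ← Finset.sum_Ioc_consecutive _ (Nat.zero_le p) hx.le]
  have : ∑ z ∈ Finset.Ioc 0 p, brk x z * Kp m z y = X * ∑ z ∈ Finset.Ioc 0 p, Kp m z y := by
    rw [Finset.mul_sum]
    apply Finset.sum_congr rfl
    intro z hz
    have := Finset.mem_Ioc.1 hz
    rw [brk, if_pos (by omega)]
  rw [this]; ring

theorem Acoef_support (n : ℕ) (b c : Fin (n + 2) → ℕ) (h : Acoef (n + 2) b c ≠ 0) :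
    ∀ i, b i ≤ c i := by
  induction n with
  | zero =>
    simp only [Acoef] at h
    have h : b 1 = c 1 ∧ b 0 ≤ c 0 := by
      by_contra hh
      exact h (if_neg hh)
    intro i
    fin_cases i
    · exact h.2
    · exact h.1.le
  | succ n ih =>
    rw [Acoef] at h
    split_ifs at h with h1
    · obtain ⟨c', hc', hne⟩ := Finset.exists_ne_zero_of_sum_ne_zero h
      have h2 := ih _ _ hne
      have h3 := (Finset.mem_Icc.1 (Finset.mem_filter.1 hc').1).2
      intro i
      refine Fin.lastCases h1.le (fun j => ?_) i
      exact (h2 j).trans (h3 j)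
    · exact absurd rfl h

theorem Acoef_det (n : ℕ) (b c : Fin (n + 2) → ℕ) (hb : StrictMono b) (hc : StrictMono c)
    (hb1 : ∀ i, 1 ≤ b i) :
    (Acoef (n + 2) b c : Polynomial ℚ) * (1 - X) ^ (∑ i, (c i - b i)) =
      Matrix.det (Matrix.of fun i j : Fin (n + 2) => Kp (n + 1 - i) (c i) (b j)) := by
  induction n with
  | zero =>
    have K1 : ∀ x y, 1 ≤ y → Kp 1 x y = if y ≤ x then (1 - X) ^ (x - y) else 0 := by
      intro x y hy
      rw [Kp_succ]
      simp only [Kp, mul_ite, mul_one, mul_zero, Finset.sum_ite_eq', Finset.mem_Icc]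
      simp [hy]
    rw [Matrix.det_fin_two]
    have hbb : b 0 < b 1 := hb (by decide)
    have hcc : c 0 < c 1 := hc (by decide)
    simp only [Matrix.of_apply, Fin.sum_univ_two]
    have e0 : (0 + 1 - ((0 : Fin 2) : ℕ)) = 1 := rfl
    have e1 : (0 + 1 - ((1 : Fin 2) : ℕ)) = 0 := rfl
    rw [e0, e1, K1 _ _ (hb1 0), K1 _ _ (hb1 1)]
    simp only [Kp, Acoef]
    by_cases h1 : b 1 = c 1
    · rw [if_neg (show ¬ b 1 ≤ c 0 by omega), if_pos h1.symm]
      by_cases h2 : b 0 ≤ c 0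
      · simp [h1, h2]
      · simp [h1, h2]
    · rw [if_neg (show ¬ (b 1 = c 1 ∧ b 0 ≤ c 0) from fun h => h1 h.1),
        if_neg (show ¬ c 1 = b 1 from fun h => h1 h.symm)]
      by_cases h2 : c 1 = b 0
      · rw [if_neg (show ¬ b 1 ≤ c 0 by omega)]; simp
      · simp [h2]
  | succ n ih =>
    rw [Acoef]
    by_cases h1 : b (Fin.last (n + 2)) = c (Fin.last (n + 2))
    · rw [if_pos h1]
      set M : Matrix (Fin (n + 3)) (Fin (n + 3)) (Polynomial ℚ) :=
        Matrix.of fun i j => Kp (n + 1 + 1 - i) (c i) (b j) with hM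
      have hdet : M.det = Matrix.det (Matrix.of fun i j : Fin (n + 2) =>
          ∑ z ∈ Finset.Icc 1 (c i.castSucc),
            (1 - X) ^ (c i.castSucc - z) * Kp (n + 1 - i) z (b j.castSucc)) := by
        rw [Matrix.det_succ_column M (Fin.last (n + 2)), Fin.sum_univ_castSucc,
          Finset.sum_eq_zero]
        · rw [zero_add]
          have hs : M (Fin.last (n + 2)) (Fin.last (n + 2)) = 1 := by
            simp [hM, Kp, h1]
          rw [hs, ← two_mul, pow_mul]
          simp only [neg_one_sq, one_pow, one_mul]
          congr 1
          ext1 i j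
          simp only [Matrix.submatrix_apply, Fin.succAbove_last, hM, Matrix.of_apply,
            Fin.val_castSucc]
          rw [show n + 1 + 1 - (i : ℕ) = (n + 1 - i) + 1 by omega, Kp_succ]
        · intro i _
          have : M i.castSucc (Fin.last (n + 2)) = 0 := by
            simp only [hM, Matrix.of_apply]
            apply Kp_eq_zero
            rw [h1]
            exact hc (Fin.castSucc_lt_last i)
          rw [this]; simp
      rw [hdet]
      have hb' : StrictMono (fun j : Fin (n + 2) => b j.castSucc) :=
        hb.comp (Fin.strictMono_castSucc)
      have hc' : StrictMono (fun j : Fin (n + 2) => c j.castSucc) :=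
        hc.comp (Fin.strictMono_castSucc)
      have hca := cancel_all (fun (i : Fin (n + 2)) z (j : Fin (n + 2)) =>
        (1 - X : Polynomial ℚ) ^ (c i.castSucc - z) * Kp (n + 1 - i) z (b j.castSucc))
        (fun j => c j.castSucc) hc' (by
          intro k hk x hx1 hx2
          have hlt : c (Fin.castSucc ⟨k, by omega⟩) < c (Fin.castSucc ⟨k + 1, hk⟩) :=
            hc' (by simp)
          refine ⟨(1 - X) ^ (c (Fin.castSucc ⟨k + 1, hk⟩) - c (Fin.castSucc ⟨k, by omega⟩)), ?_⟩
          intro j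
          simp only
          rw [show n + 1 - k = (n + 1 - (k + 1)) + 1 by omega, Kp_succ, Finset.mul_sum,
            Finset.mul_sum]
          apply Finset.sum_congr rfl
          intro z hz
          have hz := Finset.mem_Icc.1 hz
          rw [← mul_assoc, ← mul_assoc, ← pow_add, ← pow_add]
          congr 2
          omega)
      rw [← hca, Nat.cast_sum, Finset.sum_mul]
      apply Finset.sum_congr rfl
      intro c' hc'm
      have hm := Finset.mem_filter.1 hc'm
      have hle := (Finset.mem_Icc.1 hm.1).2
      have hdm := Matrix.det_mul_column (fun i => (1 - X : Polynomial ℚ) ^ (c i.castSucc - c' i))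
        (Matrix.of fun i j : Fin (n + 2) => Kp (n + 1 - i) (c' i) (b j.castSucc))
      simp only [Matrix.of_apply] at hdm
      rw [hdm, ← ih (fun j => b j.castSucc) c' hb' (fun i j h => hm.2 i j h) (fun i => hb1 _)]
      by_cases hz : Acoef (n + 2) (fun j => b j.castSucc) c' = 0
      · simp [hz]
      · have hsup := Acoef_support _ _ _ hz
        rw [Finset.prod_pow_eq_pow_sum, mul_left_comm, ← pow_add, ← Finset.sum_add_distrib,
          Fin.sum_univ_castSucc, h1, Nat.sub_self, add_zero]
        congr 2
        apply Finset.sum_congr rfl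
        intro i _
        have a1 := hsup i
        have a2 := hle i
        simp only at a1 a2
        omega
    · rw [if_neg h1]
      simp only [Nat.cast_zero, zero_mul]
      symm
      rcases lt_or_gt_of_ne h1 with h | h
      · apply Matrix.det_eq_zero_of_row_eq_zero (Fin.last (n + 2))
        intro j
        have : b j ≤ b (Fin.last (n + 2)) := hb.monotone (Fin.le_last j)
        simp [Kp]
        omega
      · apply Matrix.det_eq_zero_of_column_eq_zero (Fin.last (n + 2))
        intro i
        have : c i ≤ c (Fin.last (n + 2)) := hc.monotone (Fin.le_last i)
        apply Kp_eq_zero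
        omega

theorem braceT_det {l : ℕ} (d b : Fin l → ℕ) :
    braceT d b = Matrix.det (Matrix.of fun i j => brk (d i) (b j)) := by
  rw [Matrix.det_apply, braceT]
  rfl

theorem B1_det (n : ℕ) (b c : Fin (n + 2) → ℕ) (hc : StrictMono c) (hc1 : ∀ i, 1 ≤ c i) :
    (∑ d ∈ (Finset.Icc (fun _ => 1) c).filter (fun d => ∀ i j, i < j → d i < d j),
        (Acoef (n + 2) d c : Polynomial ℚ) * braceT d b * (1 - X) ^ (∑ i, (c i - d i))) =
      Matrix.det (Matrix.of fun i j : Fin (n + 2) => Lp (n + 1 - i) (c i) (b j)) := by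
  set N := c (Fin.last (n + 1)) with hN
  have hcN : ∀ i, c i ≤ N := fun i => hc.monotone (Fin.le_last i)
  have e : (Matrix.of fun i j : Fin (n + 2) => Lp (n + 1 - i) (c i) (b j)) =
      Matrix.of fun i j : Fin (n + 2) =>
        ∑ z ∈ Finset.Icc 1 N, Kp (n + 1 - i) (c i) z * brk z (b j) := by
    ext1 i j
    simp only [Matrix.of_apply]
    rw [Lp_sum _ _ _ _ (hc1 i) (hcN i)]
  rw [e, ← cauchy_binet' N (fun i z => Kp (n + 1 - i) (c i) z) (fun z j => brk z (b j))]
  rw [Finset.sum_subset (s₂ := (Finset.Icc (fun _ => 1) (fun _ => N)).filter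
    (fun d : Fin (n + 2) → ℕ => ∀ i j, i < j → d i < d j))]
  · apply Finset.sum_congr rfl
    intro d hd
    have hm := Finset.mem_filter.1 hd
    rw [← Acoef_det n d c (fun i j h => hm.2 i j h) hc (fun i => (Finset.mem_Icc.1 hm.1).1 i),
      braceT_det]
    ring
  · apply Finset.filter_subset_filter
    exact Finset.Icc_subset_Icc le_rfl hcN
  · intro d hd hd2
    have hz : Acoef (n + 2) d c = 0 := by
      by_contra hne
      have := Acoef_support _ _ _ hne
      have hm := Finset.mem_filter.1 hd
      exact hd2 (Finset.mem_filter.2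
        ⟨Finset.mem_Icc.2 ⟨(Finset.mem_Icc.1 hm.1).1, this⟩, hm.2⟩)
    simp [hz]

/-- predecessor value -/
def prv {n : ℕ} (c : Fin (n + 2) → ℕ) : Fin (n + 2) → ℕ :=
  Fin.cons 0 (fun i : Fin (n + 1) => c i.castSucc)

theorem prv_lt {n : ℕ} (c : Fin (n + 2) → ℕ) (hc : StrictMono c) (hc1 : ∀ i, 1 ≤ c i) (i) :
    prv c i < c i := by
  refine Fin.cases ?_ (fun j => ?_) i
  · have := hc1 0
    simp [prv]; omega
  · simp only [prv, Fin.cons_succ]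
    exact hc (Fin.castSucc_lt_succ)

theorem brkT_box {n : ℕ} (c d : Fin (n + 2) → ℕ) (hd1 : 1 ≤ d 0) (h : brkT c d ≠ 0) :
    ∀ i, prv c i < d i ∧ d i ≤ c i := by
  rw [brkT] at h
  split_ifs at h with h1
  · intro i
    constructor
    · refine Fin.cases ?_ (fun j => ?_) i
      · simp [prv]; omega
      · simp only [prv, Fin.cons_succ]
        exact h1 j.castSucc (by have := j.2; simp; omega)
    · have := Finset.prod_ne_zero_iff.1 h i (Finset.mem_univ _)
      by_contra hlt
      apply this
      rw [brk, if_neg (by omega), if_neg (by omega)]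
  · exact absurd rfl h

theorem brkT_of_box {n : ℕ} (c d : Fin (n + 2) → ℕ) (h : ∀ i, prv c i < d i) :
    brkT c d = ∏ i, brk (c i) (d i) := by
  rw [brkT, if_pos]
  intro i hi
  have := h (Fin.succ ⟨i, by omega⟩)
  simp only [prv, Fin.cons_succ] at this
  exact this

theorem B2_det (n : ℕ) (b c : Fin (n + 2) → ℕ) (hb : StrictMono b) (hc : StrictMono c)
    (hb1 : ∀ i, 1 ≤ b i) (hc1 : ∀ i, 1 ≤ c i) :
    (∑ d ∈ (Finset.Icc b c).filter (fun d => ∀ i j, i < j → d i < d j),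
        (Acoef (n + 2) b d : Polynomial ℚ) * brkT c d * (1 - X) ^ (∑ i, (d i - b i))) =
      Matrix.det (Matrix.of fun i j : Fin (n + 2) => ∑ z ∈ Finset.Ioc (prv c i) (c i),
        brk (c i) z * Kp (n + 1 - i) z (b j)) := by
  rw [det_sum_rows (fun i => Finset.Ioc (prv c i) (c i))
    (fun (i : Fin (n + 2)) z j => brk (c i) z * Kp (n + 1 - i) z (b j))]
  have hstrict : ∀ d ∈ Fintype.piFinset (fun i => Finset.Ioc (prv c i) (c i)),
      StrictMono d := by
    intro d hd
    simp only [Fintype.mem_piFinset, Finset.mem_Ioc] at hd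
    rw [Fin.strictMono_iff_lt_succ]
    intro i
    have h1 := (hd i.castSucc).2
    have h2 := (hd i.succ).1
    simp only [prv, Fin.cons_succ] at h2
    omega
  have hterm : ∀ d ∈ Fintype.piFinset (fun i => Finset.Ioc (prv c i) (c i)),
      Matrix.det (Matrix.of fun i j : Fin (n + 2) =>
        brk (c i) (d i) * Kp (n + 1 - i) (d i) (b j)) =
      (Acoef (n + 2) b d : Polynomial ℚ) * brkT c d * (1 - X) ^ (∑ i, (d i - b i)) := by
    intro d hd
    have hdm := Matrix.det_mul_column (fun i => brk (c i) (d i))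
      (Matrix.of fun i j : Fin (n + 2) => Kp (n + 1 - i) (d i) (b j))
    simp only [Matrix.of_apply] at hdm
    rw [hdm, ← Acoef_det n b d hb (hstrict d hd) hb1, brkT_of_box]
    · ring
    · simp only [Fintype.mem_piFinset, Finset.mem_Ioc] at hd
      exact fun i => (hd i).1
  rw [Finset.sum_congr rfl hterm]
  apply Finset.sum_bij_ne_zero (fun d _ _ => d)
  · intro d hd hne
    have hm := Finset.mem_filter.1 hd
    have hbr : brkT c d ≠ 0 := fun h0 => hne (by simp [h0])
    have := brkT_box c d ((hb1 0).trans ((Finset.mem_Icc.1 hm.1).1 0)) hbr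
    simp only [Fintype.mem_piFinset, Finset.mem_Ioc]
    exact this
  · intro d _ _ d' _ _ h
    exact h
  · intro d hd hne
    have hA : Acoef (n + 2) b d ≠ 0 := fun h0 => hne (by simp [h0])
    refine ⟨d, Finset.mem_filter.2 ⟨Finset.mem_Icc.2 ⟨Acoef_support _ _ _ hA, ?_⟩,
      fun i j h => hstrict d hd h⟩, hne, rfl⟩
    simp only [Fintype.mem_piFinset, Finset.mem_Ioc] at hd
    exact fun i => (hd i).2
  · intro d _ _
    rfl

/-- Theorem 3.1, first part: `B₁(b;c) = B₂(b;c)` for all `l ≥ 2` and all strictly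
increasing `l`-tuples `b, c` of positive integers, where
`B₁(b;c) = ∑_{d ∈ S_l} A(d;c) {d;b} (1-t)^{∑(cᵢ-dᵢ)}` and
`B₂(b;c) = ∑_{d ∈ S_l} A(b;d) [c;d] (1-t)^{∑(dᵢ-bᵢ)}`.  (All terms of `B₁` with `d ≰ c`
vanish since then `A(d;c) = 0`, and all terms of `B₂` with `d ∉ [b, c]` vanish since then
`A(b;d) = 0` or `[c;d] = 0`; so the finite sums below are the full sums.) -/
theorem B1_eq_B2 (l : ℕ) (hl : 2 ≤ l) (b c : Fin l → ℕ)
    (hb : StrictMono b) (hc : StrictMono c) (hb1 : ∀ i, 1 ≤ b i) (hc1 : ∀ i, 1 ≤ c i) :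
    (∑ d ∈ (Finset.Icc (fun _ => 1) c).filter (fun d => ∀ i j, i < j → d i < d j),
        (Acoef l d c : Polynomial ℚ) * braceT d b * (1 - X) ^ (∑ i, (c i - d i))) =
      ∑ d ∈ (Finset.Icc b c).filter (fun d => ∀ i j, i < j → d i < d j),
        (Acoef l b d : Polynomial ℚ) * brkT c d * (1 - X) ^ (∑ i, (d i - b i)) := by
  obtain ⟨n, rfl⟩ : ∃ n, l = n + 2 := ⟨l - 2, by omega⟩
  rw [B1_det n b c hc hc1, B2_det n b c hb hc hb1 hc1]
  apply Matrix.det_eq_of_forall_row_eq_smul_add_pred (fun _ => X)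
  · intro j
    simp only [Matrix.of_apply]
    rw [brk_row _ _ _ _ (prv_lt c hc hc1 0) (hb1 j)]
    have : Lp (n + 1 - ((0 : Fin (n + 2)) : ℕ) + 1) (prv c 0) (b j) = 0 := by
      rw [Lp_succ]; simp [prv]
    rw [this]; simp
  · intro i j
    simp only [Matrix.of_apply]
    rw [brk_row _ _ _ _ (prv_lt c hc hc1 i.succ) (hb1 j)]
    simp only [prv, Fin.cons_succ, Fin.val_succ, Fin.val_castSucc]
    rw [show n + 1 - ((i : ℕ) + 1) + 1 = n + 1 - i by omega]
    ring
end

section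
/- Main theorem (Conca–Herzog conjecture, generalized): Let Y be a one-sided ladder-shaped region of the plane, P_i = (i,n), Q_i = (m, b_i) for i = 1,…,r with b_1 < ⋯ < b_r points of Y. Let W(n,m; c_1,…,c_r) be the generating polynomial in t counting r-tuples of non-intersecting paths in Y from the P_i to the points (m, c_i) by total number of corners, and let W̃(n,m; b_1,…,b_r) = det[W(P_i, Q_j)]_{i,j} where W(P_i,Q_j) is the single-path corner generating polynomial. Then t^{-\binom{r}{2}} W̃(n,m; b_1,…,b_r) = ∑_{c ∈ S_r} A(b; c) (1-t)^{∑(c_i - b_i)} W(n,m; c_1,…,c_r). -/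
open Polynomial Finset

/-- The order on the grid: `(i,j) ≤ (i',j')` iff `i' ≤ i` and `j ≤ j'`. -/
def ple (x y : ℕ × ℕ) : Prop := y.1 ≤ x.1 ∧ x.2 ≤ y.2

/-- `C` is a path from `P` to `Q` inside the region `Y`: a maximal chain (for the order
`ple`) in `Y` with end points `P` and `Q`. -/
def IsPath (Y : Set (ℕ × ℕ)) (P Q : ℕ × ℕ) (C : Finset (ℕ × ℕ)) : Prop :=
  (C : Set (ℕ × ℕ)) ⊆ Y ∧ P ∈ C ∧ Q ∈ C ∧
  (∀ x ∈ C, ple Q x ∧ ple x P) ∧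
  (∀ x ∈ C, ∀ y ∈ C, ple x y ∨ ple y x) ∧
  (∀ z ∈ Y, ple Q z → ple z P → (∀ x ∈ C, ple x z ∨ ple z x) → z ∈ C)

/-- Number of corners of a path: points `(i,j) ∈ C` with `(i-1,j) ∈ C` and `(i,j-1) ∈ C`. -/
def cornersCount (C : Finset (ℕ × ℕ)) : ℕ :=
  (C.filter (fun p => (p.1 - 1, p.2) ∈ C ∧ (p.1, p.2 - 1) ∈ C)).card

/-- Number of paths from `P` to `Q` in `Y` with exactly `k` corners. -/
noncomputable def pathCount (Y : Set (ℕ × ℕ)) (P Q : ℕ × ℕ) (k : ℕ) : ℕ :=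
  Set.ncard {C : Finset (ℕ × ℕ) | IsPath Y P Q C ∧ cornersCount C = k}

/-- Corner-counting generating polynomial for single paths; `N` is any bound larger than
the possible number of corners, so that the sum agrees with `∑_{k ≥ 0} w_k(P,Q) tᵏ`. -/
noncomputable def Wpoly (Y : Set (ℕ × ℕ)) (P Q : ℕ × ℕ) (N : ℕ) : Polynomial ℚ :=
  ∑ k ∈ Finset.range N, (pathCount Y P Q k : Polynomial ℚ) * X ^ k

/-- Number of `r`-tuples of pairwise disjoint paths from `P i` to `Q i` in `Y` with `k`
corners in total. -/
noncomputable def tupleCount (Y : Set (ℕ × ℕ)) {r : ℕ} (P Q : Fin r → ℕ × ℕ) (k : ℕ) : ℕ :=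
  Set.ncard {C : Fin r → Finset (ℕ × ℕ) |
    (∀ i, IsPath Y (P i) (Q i) (C i)) ∧ (∀ i j, i ≠ j → Disjoint (C i) (C j)) ∧
    ∑ i, cornersCount (C i) = k}

/-- Total number of `r`-tuples of pairwise disjoint paths from `P i` to `Q i` in `Y`. -/
noncomputable def tupleCountAll (Y : Set (ℕ × ℕ)) {r : ℕ} (P Q : Fin r → ℕ × ℕ) : ℕ :=
  Set.ncard {C : Fin r → Finset (ℕ × ℕ) |
    (∀ i, IsPath Y (P i) (Q i) (C i)) ∧ (∀ i j, i ≠ j → Disjoint (C i) (C j))}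

/-- Corner-counting generating polynomial for `r`-tuples of non-intersecting paths. -/
noncomputable def WTpoly (Y : Set (ℕ × ℕ)) {r : ℕ} (P Q : Fin r → ℕ × ℕ) (N : ℕ) :
    Polynomial ℚ :=
  ∑ k ∈ Finset.range N, (tupleCount Y P Q k : Polynomial ℚ) * X ^ k

/-- Rectangular grid region `{(i,j) : 1 ≤ i ≤ m, 1 ≤ j ≤ n}`. -/
def grid (m n : ℕ) : Set (ℕ × ℕ) :=
  {p | 1 ≤ p.1 ∧ p.1 ≤ m ∧ 1 ≤ p.2 ∧ p.2 ≤ n}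

/-- One-sided ladder-shaped region with (weakly decreasing) height function `h`. -/
def ladder (m n : ℕ) (h : ℕ → ℕ) : Set (ℕ × ℕ) :=
  {p | 1 ≤ p.1 ∧ p.1 ≤ m ∧ 1 ≤ p.2 ∧ p.2 ≤ n ∧ p.2 ≤ h p.1}

namespace CH

variable {R : Type*} [CommRing R]

/-- one-variable kernel `(1-t)^(y-x)` for `x ≤ y` -/
def u (t : R) (x y : ℕ) : R := if x ≤ y then (1 - t) ^ (y - x) else 0

/-- one-variable transfer kernel -/
def nu (t : R) (x y : ℕ) : R := if x = y then 1 else if x < y then t else 0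

/-- indicator -/
def ind (R : Type*) [CommRing R] (p : Prop) [Decidable p] : R := if p then 1 else 0

theorem ind_true {p : Prop} [Decidable p] (hp : p) : ind R p = 1 := if_pos hp
theorem ind_false {p : Prop} [Decidable p] (hp : ¬ p) : ind R p = 0 := if_neg hp

/-- append a last entry -/
def sn {r : ℕ} (c : Fin r → ℕ) (x : ℕ) : Fin (r + 1) → ℕ := Fin.snoc (α := fun _ => ℕ) c x

/-- drop the last entry -/
def ini {r : ℕ} (c : Fin (r + 1) → ℕ) : Fin r → ℕ := fun i => c i.castSucc

@[simp] theorem sn_castSucc {r : ℕ} (c : Fin r → ℕ) (x : ℕ) (i : Fin r) :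
    sn c x i.castSucc = c i := by simp [sn]
@[simp] theorem sn_last {r : ℕ} (c : Fin r → ℕ) (x : ℕ) :
    sn c x (Fin.last r) = x := by simp [sn]
@[simp] theorem ini_sn {r : ℕ} (c : Fin r → ℕ) (x : ℕ) : ini (sn c x) = c := by
  funext i; simp [ini]
@[simp] theorem ini_apply {r : ℕ} (c : Fin (r + 1) → ℕ) (i : Fin r) : ini c i = c i.castSucc := rfl
theorem sn_ini {r : ℕ} (c : Fin (r + 1) → ℕ) : sn (ini c) (c (Fin.last r)) = c := by
  funext i; refine Fin.lastCases ?_ (fun i => ?_) i <;> simp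

/-- strictly increasing tuples -/
abbrev St {r : ℕ} (c : Fin r → ℕ) : Prop := ∀ i j : Fin r, i < j → c i < c j

/-- all tuples in `[1,n]` -/
def Om (r n : ℕ) : Finset (Fin r → ℕ) := Fintype.piFinset fun _ => Finset.Icc 1 n

/-- all strictly increasing tuples in `[1,n]` -/
def S (r n : ℕ) : Finset (Fin r → ℕ) := (Om r n).filter St

theorem mem_Om {r n : ℕ} {c : Fin r → ℕ} : c ∈ Om r n ↔ ∀ i, 1 ≤ c i ∧ c i ≤ n := by
  simp [Om]
theorem mem_S {r n : ℕ} {c : Fin r → ℕ} : c ∈ S r n ↔ (∀ i, 1 ≤ c i ∧ c i ≤ n) ∧ St c := by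
  simp [S, mem_Om]

theorem St_iff {r : ℕ} {c : Fin (r + 1) → ℕ} :
    St c ↔ ∀ i : Fin r, c i.castSucc < c i.succ := by
  rw [← Fin.strictMono_iff_lt_succ]; rfl

theorem sum_pi_snoc {r : ℕ} {M : Type*} [AddCommMonoid M] (s : Fin (r + 1) → Finset ℕ)
    (f : (Fin (r + 1) → ℕ) → M) :
    ∑ d ∈ Fintype.piFinset s, f d =
      ∑ d ∈ Fintype.piFinset (fun i : Fin r => s i.castSucc), ∑ x ∈ s (Fin.last r), f (sn d x) := by
  rw [← Finset.sum_product']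
  refine (Finset.sum_bij' (fun p _ => sn p.1 p.2) (fun d _ => (ini d, d (Fin.last r)))
    ?_ ?_ ?_ ?_ ?_).symm
  · rintro ⟨d, x⟩ h
    simp only [Finset.mem_product, Fintype.mem_piFinset] at h ⊢
    intro i
    refine Fin.lastCases ?_ (fun i => ?_) i
    · simpa using h.2
    · simpa using h.1 i
  · intro d h
    simp only [Finset.mem_product, Fintype.mem_piFinset] at h ⊢
    exact ⟨fun i => h _, h _⟩
  · rintro ⟨d, x⟩ h; simp
  · intro d h; exact sn_ini d
  · intros; rfl

theorem sum_Om_snoc {r n : ℕ} {M : Type*} [AddCommMonoid M] (f : (Fin (r + 1) → ℕ) → M) :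
    ∑ d ∈ Om (r + 1) n, f d = ∑ d ∈ Om r n, ∑ x ∈ Finset.Icc 1 n, f (sn d x) :=
  sum_pi_snoc _ f

/-- the weighted coefficient -/
def Aq (t : R) (n : ℕ) : (r : ℕ) → (Fin r → ℕ) → (Fin r → ℕ) → R
  | 0, _, _ => 1
  | r + 1, b, c => if b (Fin.last r) = c (Fin.last r) then
      ∑ e ∈ S r n, Aq t n r (ini b) e * ∏ i, u t (e i) (ini c i) else 0

/-- the summed weighted coefficient -/
def Bq (t : R) (n r : ℕ) (b c : Fin r → ℕ) : R :=
  ∑ e ∈ S r n, Aq t n r b e * ∏ i, u t (e i) (c i)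

theorem Aq_succ (t : R) (n r : ℕ) (b c : Fin (r + 1) → ℕ) :
    Aq t n (r + 1) b c = if b (Fin.last r) = c (Fin.last r) then Bq t n r (ini b) (ini c) else 0 :=
  rfl

theorem Aq_last (t : R) (n r : ℕ) (b c : Fin (r + 1) → ℕ) (h : Aq t n (r + 1) b c ≠ 0) :
    b (Fin.last r) = c (Fin.last r) := by
  by_contra hne; exact h (by rw [Aq_succ, if_neg hne])

theorem u_ne {t : R} {x y : ℕ} (h : u t x y ≠ 0) : x ≤ y := by
  by_contra hne; exact h (if_neg hne)

theorem nu_ne {t : R} {x y : ℕ} (h : nu t x y ≠ 0) : x ≤ y := by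
  by_contra hne; exact h (by rw [nu, if_neg (by omega), if_neg (by omega)])

theorem ind_ne {p : Prop} [Decidable p] (h : ind R p ≠ 0) : p := by
  by_contra hne; exact h (if_neg hne)

theorem prod_ne {ι : Type*} [Fintype ι] {f : ι → R} (h : ∏ i, f i ≠ 0) (i : ι) : f i ≠ 0 := by
  intro h0; exact h (Finset.prod_eq_zero (Finset.mem_univ i) h0)

theorem Aq_le (t : R) (n : ℕ) : ∀ (r : ℕ) (b c : Fin r → ℕ), Aq t n r b c ≠ 0 → ∀ i, b i ≤ c i := by
  intro r
  induction r with
  | zero => intro b c _ i; exact i.elim0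
  | succ r ih =>
    intro b c h i
    have hl := Aq_last _ _ _ _ _ h
    refine Fin.lastCases hl.le (fun i => ?_) i
    rw [Aq_succ, if_pos hl, Bq] at h
    obtain ⟨e, he, h⟩ := Finset.exists_ne_zero_of_sum_ne_zero h
    have h1 := ih _ _ (left_ne_zero_of_mul h) i
    have h2 := u_ne (prod_ne (right_ne_zero_of_mul h) i)
    simp at h1 h2; omega

/-- If `c` is strict and the coefficient does not vanish then `b` is strict. -/
theorem Aq_St (t : R) (n : ℕ) : ∀ (r : ℕ) (b c : Fin r → ℕ), St c → Aq t n r b c ≠ 0 → St b := by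
  intro r
  induction r with
  | zero => intro b c _ _ i; exact i.elim0
  | succ r ih =>
    intro b c hc h
    have hl := Aq_last _ _ _ _ _ h
    have hle := Aq_le _ _ _ _ _ h
    rw [Aq_succ, if_pos hl, Bq] at h
    obtain ⟨e, he, h⟩ := Finset.exists_ne_zero_of_sum_ne_zero h
    have h1 := ih _ _ (mem_S.1 he).2 (left_ne_zero_of_mul h)
    intro i j
    refine Fin.lastCases (fun hij => ?_) (fun j => ?_) j
    · rw [hl]; exact (hle i).trans_lt (hc _ _ hij)
    · refine Fin.lastCases (fun hij => ?_) (fun i hij => ?_) i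
      · exact absurd hij (by simp [Fin.le_last])
      · exact h1 i j (by simpa using hij)

/-! one-variable sums -/

theorem sum_u_nu (t : R) (n e y l : ℕ) (he : 1 ≤ e) (hy : y ≤ n) (hl : l < y) :
    ∑ x ∈ Finset.Icc 1 n, u t e x * (nu t x y * ind R (l < x)) =
      ind R (e ≤ y) * (1 - t) ^ (l + 1 - e) := by
  by_cases hey : e ≤ y
  · rw [ind_true hey, one_mul]
    have key : ∀ k, ∀ L, e ≤ L → L + k = y →
        ∑ x ∈ Finset.Icc L y, u t e x * nu t x y = (1 - t) ^ (L - e) := by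
      intro k
      induction k with
      | zero =>
        intro L hL h; obtain rfl : L = y := by omega
        simp [u, nu, hL]
      | succ k ih =>
        intro L hL h
        rw [← Finset.add_sum_Ioc_eq_sum_Icc (by omega), ← Finset.Icc_add_one_left_eq_Ioc,
          ih (L + 1) (by omega) (by omega)]
        rw [u, nu, if_pos hL, if_neg (by omega), if_pos (by omega),
          show L + 1 - e = (L - e) + 1 by omega]
        ring
    rw [← Finset.sum_subset (s₁ := Finset.Icc (max e (l+1)) y)]
    · rw [Finset.sum_congr rfl (g := fun x => u t e x * nu t x y)]
      · rw [key (y - max e (l+1)) _ (by omega) (by omega)]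
        congr 1; omega
      · intro x hx; rw [Finset.mem_Icc] at hx; rw [ind_true (by omega), mul_one]
    · intro x hx; rw [Finset.mem_Icc] at *; omega
    · intro x _ hx; rw [Finset.mem_Icc] at *
      by_contra h
      have h1 := u_ne (left_ne_zero_of_mul h)
      have h2 := nu_ne (left_ne_zero_of_mul (right_ne_zero_of_mul h))
      have h3 := ind_ne (right_ne_zero_of_mul (right_ne_zero_of_mul h))
      omega
  · rw [ind_false hey, zero_mul]
    refine Finset.sum_eq_zero fun x _ => ?_
    by_contra h
    have h1 := u_ne (left_ne_zero_of_mul h)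
    have h2 := nu_ne (left_ne_zero_of_mul (right_ne_zero_of_mul h))
    omega

theorem sum_nu_u (t : R) (n c c2 y : ℕ) (hc : 1 ≤ c) (hy : y ≤ n) (hl : c < c2) :
    ∑ x ∈ Finset.Icc 1 n, nu t c x * ind R (x < c2) * u t x y =
      ind R (c ≤ y) * (1 - t) ^ (y + 1 - c2) := by
  by_cases hey : c ≤ y
  · rw [ind_true hey, one_mul]
    have key : ∀ k, ∀ L, L ≤ y → c + k = L →
        ∑ x ∈ Finset.Icc c L, nu t c x * u t x y = (1 - t) ^ (y - L) := by
      intro k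
      induction k with
      | zero =>
        intro L hL h; obtain rfl : c = L := by omega
        simp [u, nu, hL]
      | succ k ih =>
        intro L hL h
        obtain rfl : L = (c + k) + 1 := by omega
        rw [Finset.sum_Icc_succ_top (by omega), ih (c + k) (by omega) (by omega)]
        rw [u, nu, if_pos hL, if_neg (by omega), if_pos (by omega),
          show y - (c + k) = (y - (c + k + 1)) + 1 by omega]
        ring
    rw [← Finset.sum_subset (s₁ := Finset.Icc c (min (c2 - 1) y))]
    · rw [Finset.sum_congr rfl (g := fun x => nu t c x * u t x y)]
      · rw [key (min (c2 - 1) y - c) _ (by omega) (by omega)]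
        congr 1; omega
      · intro x hx; rw [Finset.mem_Icc] at hx; rw [ind_true (by omega), mul_one]
    · intro x hx; rw [Finset.mem_Icc] at *; omega
    · intro x _ hx; rw [Finset.mem_Icc] at *
      by_contra h
      have h1 := u_ne (right_ne_zero_of_mul h)
      have h2 := nu_ne (left_ne_zero_of_mul (left_ne_zero_of_mul h))
      have h3 := ind_ne (right_ne_zero_of_mul (left_ne_zero_of_mul h))
      omega
  · rw [ind_false hey, zero_mul]
    refine Finset.sum_eq_zero fun x _ => ?_
    by_contra h
    have h1 := u_ne (right_ne_zero_of_mul h)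
    have h2 := nu_ne (left_ne_zero_of_mul (left_ne_zero_of_mul h))
    omega

theorem sum_nu_u' (t : R) (n c y : ℕ) (hc : 1 ≤ c) (hy : y ≤ n) :
    ∑ x ∈ Finset.Icc 1 n, nu t c x * u t x y = ind R (c ≤ y) := by
  have := sum_nu_u t n c (n + c + 1) y hc hy (by omega)
  rw [show y + 1 - (n + c + 1) = 0 by omega, pow_zero, mul_one] at this
  rw [← this]
  refine Finset.sum_congr rfl fun x hx => ?_
  rw [Finset.mem_Icc] at hx
  rw [ind_true (by omega), mul_one]

theorem sum_L_u (t : R) (n b b' y : ℕ) (hb : 1 ≤ b) (hbb : b ≤ b') (hy : y ≤ n) :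
    ∑ x ∈ Finset.Icc 1 n, (nu t b x - nu t b' x) * u t x y = ind R (b ≤ y ∧ y < b') := by
  simp only [sub_mul, Finset.sum_sub_distrib]
  rw [sum_nu_u' t n b y hb hy, sum_nu_u' t n b' y (by omega) hy]
  unfold ind
  split_ifs <;> first | omega | simp

end CH

namespace CH

variable {R : Type*} [CommRing R]

/-- interlacing transfer kernel -/
def Nk (t : R) {r : ℕ} (c : Fin (r + 1) → ℕ) (c' : Fin r → ℕ) : R :=
  ∏ i : Fin r, (nu t (c i.castSucc) (c' i) * ind R (c' i < c i.succ))

theorem Nk_ne {t : R} {r : ℕ} {c : Fin (r + 1) → ℕ} {c' : Fin r → ℕ} (h : Nk t c c' ≠ 0)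
    (i : Fin r) : c i.castSucc ≤ c' i ∧ c' i < c i.succ := by
  have := prod_ne h i
  exact ⟨nu_ne (left_ne_zero_of_mul this), ind_ne (right_ne_zero_of_mul this)⟩

theorem Nk_St {t : R} {r : ℕ} {c : Fin (r + 1) → ℕ} {c' : Fin r → ℕ} (h : Nk t c c' ≠ 0) :
    St c := by
  rw [St_iff]; intro i
  have := Nk_ne h i; omega

theorem inter_St {r : ℕ} {c : Fin (r + 1) → ℕ} {c' : Fin r → ℕ}
    (h : ∀ i : Fin r, c i.castSucc ≤ c' i ∧ c' i < c i.succ) : St c' := by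
  cases r with
  | zero => intro i; exact i.elim0
  | succ r =>
    rw [St_iff]; intro i
    have h1 := h i.castSucc
    have h2 := h i.succ
    rw [Fin.succ_castSucc] at h1
    omega

theorem Nk_St' {t : R} {r : ℕ} {c : Fin (r + 1) → ℕ} {c' : Fin r → ℕ} (h : Nk t c c' ≠ 0) :
    St c' := inter_St (Nk_ne h)

/-- interlacing box -/
def box {r : ℕ} (b : Fin (r + 1) → ℕ) : Finset (Fin r → ℕ) :=
  Fintype.piFinset fun i : Fin r => Finset.Ico (b i.castSucc) (b i.succ)

theorem mem_box {r : ℕ} {b : Fin (r + 1) → ℕ} {d : Fin r → ℕ} :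
    d ∈ box b ↔ ∀ i : Fin r, b i.castSucc ≤ d i ∧ d i < b i.succ := by
  simp [box]

theorem sum_box_snoc {r : ℕ} {M : Type*} [AddCommMonoid M] (b : Fin (r + 2) → ℕ)
    (f : (Fin (r + 1) → ℕ) → M) :
    ∑ d ∈ box b, f d = ∑ d ∈ box (ini b), ∑ x ∈ Finset.Ico (b (Fin.last r).castSucc)
      (b (Fin.last (r + 1))), f (sn d x) := by
  rw [box, sum_pi_snoc]
  rfl

theorem St_ini {r : ℕ} {c : Fin (r + 1) → ℕ} (h : St c) : St (ini c) := by
  intro i j hij; exact h _ _ (by simpa using hij)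

theorem ini_mem_S {r n : ℕ} {c : Fin (r + 1) → ℕ} (h : c ∈ S (r + 1) n) : ini c ∈ S r n := by
  rw [mem_S] at *
  exact ⟨fun i => h.1 _, St_ini h.2⟩

theorem ini_mem_Om {r n : ℕ} {c : Fin (r + 1) → ℕ} (h : c ∈ Om (r + 1) n) : ini c ∈ Om r n := by
  rw [mem_Om] at *
  exact fun i => h _

theorem S_sub_Om {r n : ℕ} {c : Fin r → ℕ} (h : c ∈ S r n) : c ∈ Om r n :=
  (Finset.mem_filter.1 h).1

/-- auxiliary product -/
def Mk (t : R) {r : ℕ} (e c' : Fin (r + 1) → ℕ) : R :=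
  (∏ i : Fin r, ind R (e i.castSucc ≤ c' i.castSucc)) *
    ∏ i : Fin r, (1 - t) ^ (c' i.castSucc + 1 - e i.succ)

theorem lhs_aux (t : R) (n r : ℕ) (bl : ℕ) (e c' : Fin (r + 1) → ℕ)
    (he : e ∈ Om (r + 1) n) (hc : c' ∈ S (r + 1) n) :
    ∑ c ∈ Om (r + 1) n, (∏ i, u t (e i) (c i)) * Nk t (sn c bl) c' =
      ind R (c' (Fin.last r) < bl) * (ind R (e (Fin.last r) ≤ c' (Fin.last r)) * Mk t e c') := by
  rw [mem_S] at hc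
  rw [mem_Om] at he
  let lo : Fin (r + 1) → ℕ := Fin.cons (α := fun _ => ℕ) 0 (fun i : Fin r => c' i.castSucc)
  have lo0 : lo 0 = 0 := rfl
  have los : ∀ i : Fin r, lo i.succ = c' i.castSucc := fun i => rfl
  have hlo : ∀ i, lo i < c' i := by
    intro i
    refine Fin.cases ?_ (fun i => ?_) i
    · rw [lo0]; exact (hc.1 0).1
    · rw [los]; exact hc.2 _ _ i.castSucc_lt_succ
  have h1 : ∀ c ∈ Om (r + 1) n, (∏ i, u t (e i) (c i)) * Nk t (sn c bl) c' =
      ind R (c' (Fin.last r) < bl) *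
        ∏ i, (u t (e i) (c i) * (nu t (c i) (c' i) * ind R (lo i < c i))) := by
    intro c hcm
    rw [mem_Om] at hcm
    rw [Finset.prod_mul_distrib, Finset.prod_mul_distrib, Nk, Finset.prod_mul_distrib,
      Fin.prod_univ_succ (f := fun i => ind R (lo i < c i)),
      Fin.prod_univ_castSucc (f := fun i : Fin (r + 1) => ind R (c' i < sn c bl i.succ))]
    have : ∀ i : Fin r, sn c bl i.castSucc.succ = c i.succ := by
      intro i; rw [Fin.succ_castSucc, sn_castSucc]
    simp only [sn_castSucc, this, Fin.succ_last, sn_last, los, lo0]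
    rw [ind_true (show 0 < c 0 from (hcm 0).1)]
    ring
  rw [Finset.sum_congr rfl h1, ← Finset.mul_sum, Om,
    ← Finset.prod_univ_sum (fun _ => Finset.Icc 1 n)
      (fun i x => u t (e i) x * (nu t x (c' i) * ind R (lo i < x)))]
  congr 1
  rw [Finset.prod_congr rfl (fun i _ => sum_u_nu t n (e i) (c' i) (lo i) (he i).1 (hc.1 i).2 (hlo i)),
    Finset.prod_mul_distrib, Fin.prod_univ_castSucc, Fin.prod_univ_succ, Mk]
  simp only [los, lo0]
  rw [show 0 + 1 - e 0 = 0 by have := (he 0).1; omega]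
  ring

theorem rhs_aux (t : R) (n r : ℕ) (c c' : Fin (r + 1) → ℕ)
    (hc : c ∈ S (r + 1) n) (hc' : c' ∈ Om (r + 1) n) :
    ∑ f ∈ S r n, Nk t c f * (∏ i, u t (f i) (ini c' i)) = Mk t c c' := by
  rw [mem_S] at hc
  rw [mem_Om] at hc'
  rw [S, Finset.sum_filter_of_ne (fun f _ h => Nk_St' (left_ne_zero_of_mul h))]
  simp only [Nk, ← Finset.prod_mul_distrib]
  rw [Om, ← Finset.prod_univ_sum (fun _ => Finset.Icc 1 n)
      (fun i x => nu t (c i.castSucc) x * ind R (x < c i.succ) * u t x (ini c' i))]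
  rw [Finset.prod_congr rfl (fun i _ => sum_nu_u t n (c i.castSucc) (c i.succ) (ini c' i) (hc.1 _).1 (hc' _).2
    (hc.2 _ _ i.castSucc_lt_succ)), Finset.prod_mul_distrib, Mk]
  rfl

theorem sum_Icc_eq {n b : ℕ} {M : Type*} [AddCommMonoid M] (f : ℕ → M) (hb : 1 ≤ b ∧ b ≤ n) :
    ∑ x ∈ Finset.Icc 1 n, (if b = x then f x else 0) = f b := by
  rw [Finset.sum_ite_eq, if_pos (Finset.mem_Icc.2 hb)]

/-- Second identity, variant. -/
theorem id2 (t : R) (n : ℕ) : ∀ (r : ℕ) (b : Fin (r + 1) → ℕ) (c' : Fin r → ℕ),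
    b ∈ S (r + 1) n → c' ∈ S r n →
    ∑ c ∈ S (r + 1) n, Aq t n (r + 1) b c * Nk t c c' = ∑ d ∈ box b, Aq t n r d c' := by
  intro r
  induction r with
  | zero =>
    intro b c' hb _
    rw [S, Finset.sum_filter_of_ne (fun f _ h => Nk_St (right_ne_zero_of_mul h)), sum_Om_snoc]
    rw [mem_S] at hb
    have hS : S 0 n = {fun i => i.elim0} := by
      ext c; rw [mem_S, Finset.mem_singleton]
      constructor
      · intro _; funext i; exact i.elim0
      · intro _; exact ⟨fun i => i.elim0, fun i => i.elim0⟩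
    have := hb.1 0
    have h0 : ∀ (d : Fin 0 → ℕ) (x : ℕ), sn d x 0 = x := fun d x => sn_last d x
    have h2 := sum_Icc_eq (fun _ => (1 : R)) this
    simp [Aq, Nk, box, Om, hS, h0] at h2 ⊢
    exact h2
  | succ r ih =>
    intro b c' hb hc'
    have hb' := mem_S.1 hb
    have hcm := mem_S.1 hc'
    trans ∑ e ∈ S (r + 1) n, Aq t n (r + 1) (ini b) e *
      (ind R (c' (Fin.last r) < b (Fin.last (r + 1))) *
        (ind R (e (Fin.last r) ≤ c' (Fin.last r)) * Mk t e c'))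
    · rw [S, Finset.sum_filter_of_ne (fun f _ h => Nk_St (right_ne_zero_of_mul h)), sum_Om_snoc]
      simp only [Aq_succ t n (r + 1), sn_last, ini_sn, ite_mul, zero_mul]
      have : ∀ d ∈ Om (r + 1) n, ∑ x ∈ Finset.Icc 1 n, (if b (Fin.last (r + 1)) = x then
          Bq t n (r + 1) (ini b) d * Nk t (sn d x) c' else 0) =
          ∑ e ∈ S (r + 1) n, Aq t n (r + 1) (ini b) e * ((∏ i, u t (e i) (d i)) *
            Nk t (sn d (b (Fin.last (r + 1)))) c') := by
        intro d _
        rw [sum_Icc_eq _ (hb'.1 _), Bq, Finset.sum_mul]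
        exact Finset.sum_congr rfl fun e _ => by ring
      rw [Finset.sum_congr rfl this, Finset.sum_comm]
      refine Finset.sum_congr rfl fun e he => ?_
      rw [← Finset.mul_sum, lhs_aux t n r _ e c' (S_sub_Om he) hc']
    · rw [sum_box_snoc]
      simp only [Aq_succ t n r _ c', sn_last, ini_sn]
      have h1 : ∀ d ∈ box (ini b), ∑ x ∈ Finset.Ico (b (Fin.last r).castSucc) (b (Fin.last (r + 1))),
          (if x = c' (Fin.last r) then Bq t n r d (ini c') else 0) =
          ind R (b (Fin.last r).castSucc ≤ c' (Fin.last r) ∧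
            c' (Fin.last r) < b (Fin.last (r + 1))) *
            Bq t n r d (ini c') := by
        intro d _
        rw [Finset.sum_ite_eq', ind]
        simp only [Finset.mem_Ico, ite_mul, one_mul, zero_mul]
      rw [Finset.sum_congr rfl h1, ← Finset.mul_sum]
      have h2 : ∑ d ∈ box (ini b), Bq t n r d (ini c') =
          ∑ e ∈ S (r + 1) n, Aq t n (r + 1) (ini b) e * Mk t e c' := by
        simp only [Bq]
        rw [Finset.sum_comm]
        have : ∀ f ∈ S r n, ∑ d ∈ box (ini b), Aq t n r d f * ∏ i, u t (f i) (ini c' i) =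
            ∑ e ∈ S (r + 1) n, Aq t n (r + 1) (ini b) e *
              (Nk t e f * ∏ i, u t (f i) (ini c' i)) := by
          intro f hf
          rw [← Finset.sum_mul, ← ih (ini b) f (ini_mem_S hb) hf, Finset.sum_mul]
          exact Finset.sum_congr rfl fun e _ => by ring
        rw [Finset.sum_congr rfl this, Finset.sum_comm]
        refine Finset.sum_congr rfl fun e he => ?_
        rw [← Finset.mul_sum, rhs_aux t n r e c' he (S_sub_Om hc')]
      rw [h2, Finset.mul_sum]
      refine Finset.sum_congr rfl fun e he => ?_
      by_cases h0 : Aq t n (r + 1) (ini b) e = 0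
      · rw [h0]; ring
      · have hl := Aq_last _ _ _ _ _ h0
        rw [ini_apply] at hl
        rw [hl]
        unfold ind
        split_ifs <;> first | omega | ring | (exfalso; tauto)

/-- difference kernel -/
def Lk (t : R) (b b' x : ℕ) : R := nu t b x - nu t b' x

theorem Lk_ne {t : R} {b b' x : ℕ} (hb : b ≤ b') (h : Lk t b b' x ≠ 0) : b ≤ x ∧ x ≤ b' := by
  by_contra hn
  apply h
  unfold Lk nu
  split_ifs <;> first | omega | simp

theorem Bq_succ (t : R) (n r : ℕ) (d c : Fin (r + 1) → ℕ) (hd : d ∈ Om (r + 1) n) :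
    Bq t n (r + 1) d c = u t (d (Fin.last r)) (c (Fin.last r)) *
      ∑ g ∈ S r n, (if ∀ i, g i < d (Fin.last r) then
        Bq t n r (ini d) g * ∏ i, u t (g i) (ini c i) else 0) := by
  rw [mem_Om] at hd
  have hst : ∀ (g : Fin r → ℕ) (x : ℕ), St (sn g x) ↔ St g ∧ ∀ i, g i < x := by
    intro g x
    constructor
    · intro h
      refine ⟨fun i j hij => ?_, fun i => ?_⟩
      · have := h i.castSucc j.castSucc (by simpa using hij); simpa using this
      · have := h i.castSucc (Fin.last r) (Fin.castSucc_lt_last i); simpa using this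
    · rintro ⟨h1, h2⟩ i j
      refine Fin.lastCases (fun hij => ?_) (fun j => ?_) j
      · revert hij
        refine Fin.lastCases (fun hij => absurd hij (lt_irrefl _)) (fun i _ => ?_) i
        simpa using h2 i
      · refine Fin.lastCases (fun hij => ?_) (fun i hij => ?_) i
        · exact absurd hij (by simp [Fin.le_last])
        · simpa using h1 i j (by simpa using hij)
  rw [Bq, S, Finset.sum_filter, sum_Om_snoc, S, Finset.sum_filter, Finset.mul_sum]
  refine Finset.sum_congr rfl fun g _ => ?_
  simp only [hst, Aq_succ, sn_last, ini_sn, Fin.prod_univ_castSucc, sn_castSucc]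
  rw [Finset.sum_congr rfl (g := fun x => if d (Fin.last r) = x then
      (if St g ∧ ∀ i, g i < x then Bq t n r (ini d) g *
        ((∏ i, u t (g i) (c i.castSucc)) * u t x (c (Fin.last r))) else 0) else 0)]
  · rw [sum_Icc_eq _ (hd _)]
    by_cases h1 : St g
    · by_cases h2 : ∀ i, g i < d (Fin.last r)
      · rw [if_pos ⟨h1, h2⟩, if_pos h1, if_pos h2]; simp only [ini_apply]; ring
      · rw [if_neg (fun h => h2 h.2), if_pos h1, if_neg h2, mul_zero]
    · rw [if_neg (fun h => h1 h.1), if_neg h1, mul_zero]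
  · intro x _
    split_ifs <;> simp

/-- Identity 3. -/
theorem id3 (t : R) (n : ℕ) : ∀ (r : ℕ) (b : Fin (r + 1) → ℕ) (c' : Fin r → ℕ),
    b ∈ S (r + 1) n → c' ∈ Om r n →
    ∑ d ∈ Om r n, (∏ j : Fin r, Lk t (b j.castSucc) (b j.succ) (d j)) * Bq t n r d c' =
      ∑ d ∈ box b, Aq t n r d c' := by
  intro r
  induction r with
  | zero =>
    intro b c' hb _
    have hS : S 0 n = {fun i => i.elim0} := by
      ext c; rw [mem_S, Finset.mem_singleton]
      constructor
      · intro _; funext i; exact i.elim0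
      · intro _; exact ⟨fun i => i.elim0, fun i => i.elim0⟩
    simp [Aq, box, Om, Bq, hS]
  | succ r ih =>
    intro b c' hb hc'
    have hb' := mem_S.1 hb
    have hcm := mem_Om.1 hc'
    have hbl : b (Fin.last r).castSucc < b (Fin.last (r + 1)) :=
      hb'.2 _ _ (Fin.castSucc_lt_last _)
    trans ind R (b (Fin.last r).castSucc ≤ c' (Fin.last r) ∧
            c' (Fin.last r) < b (Fin.last (r + 1))) * ∑ d ∈ box (ini b), Bq t n r d (ini c')
    · rw [sum_Om_snoc, Finset.sum_comm]
      rw [← sum_L_u t n _ _ _ (hb'.1 _).1 hbl.le (hcm _).2, Finset.sum_mul]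
      refine Finset.sum_congr rfl fun x hx => ?_
      rw [Finset.mem_Icc] at hx
      have h1 : ∀ d ∈ Om r n,
          (∏ j : Fin (r + 1), Lk t (b j.castSucc) (b j.succ) (sn d x j)) *
            Bq t n (r + 1) (sn d x) c' =
          (nu t (b (Fin.last r).castSucc) x - nu t (b (Fin.last (r + 1))) x) *
            u t x (c' (Fin.last r)) *
          ∑ g ∈ S r n, (if ∀ i, g i < x then
            ((∏ j : Fin r, Lk t (ini b j.castSucc) (ini b j.succ) (d j)) * Bq t n r d g) *
              ∏ i, u t (g i) (ini c' i) else 0) := by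
        intro d hd
        have hd' : sn d x ∈ Om (r + 1) n := by
          rw [mem_Om] at *
          intro i
          refine Fin.lastCases ?_ (fun i => ?_) i
          · simpa using hx
          · simpa using hd i
        rw [Bq_succ t n r _ _ hd', Fin.prod_univ_castSucc]
        simp only [sn_castSucc, sn_last, ini_sn, Fin.succ_last, ini_apply, Fin.succ_castSucc]
        rw [Finset.mul_sum, Finset.mul_sum, Finset.mul_sum]
        refine Finset.sum_congr rfl fun g _ => ?_
        split_ifs
        · rw [Lk]; ring
        · simp
      rw [Finset.sum_congr rfl h1, ← Finset.mul_sum, Finset.sum_comm]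
      by_cases hL : nu t (b (Fin.last r).castSucc) x - nu t (b (Fin.last (r + 1))) x = 0
      · rw [hL]; simp
      have hx2 := Lk_ne hbl.le hL
      congr 1
      simp only [Bq]
      rw [Finset.sum_comm (s := box (ini b))]
      refine Finset.sum_congr rfl fun g hg => ?_
      rw [← Finset.sum_mul, ← ih (ini b) g (ini_mem_S hb) (S_sub_Om hg)]
      by_cases hgx : ∀ i, g i < x
      · simp only [if_pos hgx, ← Finset.sum_mul]
        rfl
      · simp only [if_neg hgx, Finset.sum_const_zero]
        rw [ih (ini b) g (ini_mem_S hb) (S_sub_Om hg)]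
        symm
        convert zero_mul _
        refine Finset.sum_eq_zero fun d hd => ?_
        by_contra hne
        apply hgx
        have hgS := (mem_S.1 hg).2
        cases r with
        | zero => intro i; exact i.elim0
        | succ r =>
          intro i
          have e1 := Aq_last _ _ _ _ _ hne
          have e2 := (mem_box.1 hd (Fin.last r)).2
          have e3 : g i ≤ g (Fin.last r) := by
            rcases (Fin.le_last i).lt_or_eq with h | h
            · exact (hgS _ _ h).le
            · rw [h]
          have e4 : ini b (Fin.last r).succ = b (Fin.last (r + 1)).castSucc := rfl
          omega
    · rw [sum_box_snoc, Finset.mul_sum]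
      refine Finset.sum_congr rfl fun d _ => ?_
      simp only [Aq_succ t n r _ c', sn_last, ini_sn]
      rw [Finset.sum_ite_eq', ind]
      simp only [Finset.mem_Ico, ite_mul, one_mul, zero_mul]

end CH

namespace CH

variable {R : Type*} [CommRing R]

theorem det_multi {r : ℕ} (s : Fin r → Finset ℕ) (k : Fin r → ℕ → R) (w : Fin r → ℕ → R) :
    Matrix.det (Matrix.of fun i j : Fin r => ∑ x ∈ s j, k j x * w i x) =
      ∑ d ∈ Fintype.piFinset s, (∏ j, k j (d j)) *
        Matrix.det (Matrix.of fun i j : Fin r => w i (d j)) := by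
  simp only [Matrix.det_apply', Matrix.of_apply]
  simp only [Finset.prod_univ_sum, Finset.mul_sum]
  rw [Finset.sum_comm]
  refine Finset.sum_congr rfl fun d _ => Finset.sum_congr rfl fun σ _ => ?_
  rw [Finset.prod_mul_distrib]; ring

theorem det_coldiff {r : ℕ} (M : Fin (r + 1) → Fin (r + 1) → R) :
    Matrix.det (Matrix.of M) = Matrix.det (Matrix.of fun i : Fin (r + 1) =>
      (Fin.snoc (α := fun _ => R) (fun j : Fin r => M i j.castSucc - M i j.succ)
        (M i (Fin.last r)) : Fin (r + 1) → R)) := by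
  let T : Matrix (Fin (r + 1)) (Fin (r + 1)) R := Matrix.of fun k j =>
    (if k = j then 1 else 0) - (if (k : ℕ) = j + 1 then 1 else 0)
  have hT : T.det = 1 := by
    rw [Matrix.det_of_lowerTriangular]
    · simp [T]
    · intro i j hij
      have hij' : i < j := hij
      have h1 : ¬ i = j := hij'.ne
      have h2 : ¬ (i : ℕ) = j + 1 := by have : (i : ℕ) < j := hij'; omega
      simp [T, h1, h2]
  have : Matrix.det (Matrix.of M) = Matrix.det (Matrix.of M * T) := by
    rw [Matrix.det_mul, hT, mul_one]
  rw [this]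
  congr 1
  ext i j
  rw [Matrix.mul_apply]
  simp only [Matrix.of_apply, T, mul_sub, Finset.sum_sub_distrib, mul_ite, mul_one, mul_zero,
    Finset.sum_ite_eq', Finset.mem_univ, if_true]
  refine Fin.lastCases ?_ (fun j => ?_) j
  · rw [Fin.snoc_last]
    rw [Finset.sum_eq_zero, sub_zero]
    intro x _
    rw [if_neg]
    simp only [Fin.val_last]; omega
  · rw [Fin.snoc_castSucc]
    congr 1
    rw [Finset.sum_eq_single j.succ]
    · simp
    · intro k _ hk
      rw [if_neg]
      intro h; apply hk; ext; simpa using h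
    · simp

theorem det_lastones {r : ℕ} (M : Fin (r + 1) → Fin (r + 1) → R)
    (h1 : ∀ j, M (Fin.last r) j = 1) :
    Matrix.det (Matrix.of M) = Matrix.det (Matrix.of fun i j : Fin r =>
      M i.castSucc j.castSucc - M i.castSucc j.succ) := by
  rw [det_coldiff, Matrix.det_succ_row _ (Fin.last r), Fin.sum_univ_castSucc]
  rw [Finset.sum_eq_zero, zero_add]
  · simp only [Matrix.of_apply, Fin.snoc_last, h1]
    rw [← two_mul, pow_mul]
    simp only [neg_one_sq, one_pow, one_mul]
    congr 1
    ext i j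
    simp
  · intro j _
    simp [h1]

theorem transfer {r n H : ℕ} (t : R) (w w' : Fin (r + 1) → ℕ → R)
    (hw : ∀ i b, 1 ≤ b → b ≤ n → b ≤ H → w' i b =
      ∑ x ∈ Finset.Icc 1 n, nu t b x * ind R (x ≤ H) * w i x)
    (b : Fin (r + 1) → ℕ) (hb : b ∈ S (r + 1) n) (hbH : ∀ i, b i ≤ H) :
    Matrix.det (Matrix.of fun i j : Fin (r + 1) => w' i (b j)) =
      ∑ d ∈ Om (r + 1) n, (∏ j : Fin r, Lk t (b j.castSucc) (b j.succ) (d j.castSucc)) *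
        (nu t (b (Fin.last r)) (d (Fin.last r)) * ind R (d (Fin.last r) ≤ H)) *
        Matrix.det (Matrix.of fun i j : Fin (r + 1) => w i (d j)) := by
  rw [det_coldiff]
  rw [mem_S] at hb
  let k : Fin (r + 1) → ℕ → R := Fin.snoc (α := fun _ => ℕ → R)
    (fun j : Fin r => fun x => Lk t (b j.castSucc) (b j.succ) x)
    (fun x => nu t (b (Fin.last r)) x * ind R (x ≤ H))
  have hk1 : ∀ j : Fin r, k j.castSucc = fun x => Lk t (b j.castSucc) (b j.succ) x := by
    intro j; simp [k]
  have hk2 : k (Fin.last r) = fun x => nu t (b (Fin.last r)) x * ind R (x ≤ H) := by simp [k]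
  have : ∀ d : Fin (r + 1) → ℕ,
      (∏ j : Fin r, Lk t (b j.castSucc) (b j.succ) (d j.castSucc)) *
        (nu t (b (Fin.last r)) (d (Fin.last r)) * ind R (d (Fin.last r) ≤ H)) =
      ∏ j, k j (d j) := by
    intro d; rw [Fin.prod_univ_castSucc]; simp only [hk1, hk2]
  simp only [this]
  rw [Om, ← det_multi]
  congr 1
  ext i j
  simp only [Matrix.of_apply]
  refine Fin.lastCases ?_ (fun j => ?_) j
  · rw [Fin.snoc_last, hk2]
    exact hw i _ (hb.1 _).1 (hb.1 _).2 (hbH _)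
  · rw [Fin.snoc_castSucc, hk1, hw i _ (hb.1 _).1 (hb.1 _).2 (hbH _),
      hw i _ (hb.1 _).1 (hb.1 _).2 (hbH _), ← Finset.sum_sub_distrib]
    refine Finset.sum_congr rfl fun x _ => ?_
    beta_reduce
    by_cases hx : x ≤ H
    · rw [ind_true hx, Lk]; ring
    · have h0 : Lk t (b j.castSucc) (b j.succ) x = 0 := by
        by_contra hne
        have h1 := Lk_ne (hb.2 _ _ j.castSucc_lt_succ).le hne
        have := hbH j.succ
        omega
      rw [ind_false hx, h0]; ring

theorem step {r n H H' : ℕ} (t T : R) (hHH : H ≤ H') (w w' : Fin (r + 1) → ℕ → R)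
    (F F' : (Fin (r + 1) → ℕ) → R)
    (hw : ∀ i b, 1 ≤ b → b ≤ n → b ≤ H → w' i b =
      ∑ x ∈ Finset.Icc 1 n, nu t b x * ind R (x ≤ H) * w i x)
    (hF : ∀ c ∈ S (r + 1) n, F' c = ∑ c' ∈ Om (r + 1) n, Nk t c (ini c') *
      (nu t (c (Fin.last r)) (c' (Fin.last r)) * ind R (c' (Fin.last r) ≤ H)) * F c')
    (ih : ∀ d ∈ S (r + 1) n, (∀ i, d i ≤ H') →
      Matrix.det (Matrix.of fun i j : Fin (r + 1) => w i (d j)) =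
        T * ∑ c ∈ S (r + 1) n, Aq t n (r + 1) d c * F c)
    (b : Fin (r + 1) → ℕ) (hb : b ∈ S (r + 1) n) (hbH : ∀ i, b i ≤ H) :
    Matrix.det (Matrix.of fun i j : Fin (r + 1) => w' i (b j)) =
        T * ∑ c ∈ S (r + 1) n, Aq t n (r + 1) b c * F' c := by
  rw [transfer t w w' hw b hb hbH]
  have hb' := mem_S.1 hb
  have h1 : ∀ d ∈ Om (r + 1) n,
      (∏ j : Fin r, Lk t (b j.castSucc) (b j.succ) (d j.castSucc)) *
        (nu t (b (Fin.last r)) (d (Fin.last r)) * ind R (d (Fin.last r) ≤ H)) *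
        Matrix.det (Matrix.of fun i j : Fin (r + 1) => w i (d j)) =
      (∏ j : Fin r, Lk t (b j.castSucc) (b j.succ) (d j.castSucc)) *
        (nu t (b (Fin.last r)) (d (Fin.last r)) * ind R (d (Fin.last r) ≤ H)) *
        (T * ∑ c ∈ S (r + 1) n, Aq t n (r + 1) d c * F c) := by
    intro d hd
    by_cases hz : (∏ j : Fin r, Lk t (b j.castSucc) (b j.succ) (d j.castSucc)) *
        (nu t (b (Fin.last r)) (d (Fin.last r)) * ind R (d (Fin.last r) ≤ H)) = 0
    · rw [hz, zero_mul, zero_mul]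
    congr 1
    have z1 : ∀ j : Fin r, b j.castSucc ≤ d j.castSucc ∧ d j.castSucc ≤ b j.succ := fun j =>
      Lk_ne (hb'.2 _ _ j.castSucc_lt_succ).le (prod_ne (left_ne_zero_of_mul hz) j)
    have z2 := nu_ne (left_ne_zero_of_mul (right_ne_zero_of_mul hz))
    have z3 := ind_ne (right_ne_zero_of_mul (right_ne_zero_of_mul hz))
    have hlow : ∀ j, b j ≤ d j := by
      intro j; exact Fin.lastCases z2 (fun j => (z1 j).1) j
    have hmono : Monotone d := by
      rw [Fin.monotone_iff_le_succ]
      intro j; exact (z1 j).2.trans (hlow _)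
    by_cases hst : St d
    · refine ih d (mem_S.2 ⟨mem_Om.1 hd, hst⟩) (fun i => ?_)
      exact (hmono (Fin.le_last i)).trans (z3.trans hHH)
    · rw [Finset.sum_eq_zero, mul_zero]
      · have : ∃ i j : Fin (r + 1), i < j ∧ d i = d j := by
          by_contra hcon
          push Not at hcon
          exact hst fun i j hij => lt_of_le_of_ne (hmono hij.le) (hcon i j hij)
        obtain ⟨i, j, hij, hdij⟩ := this
        refine Matrix.det_zero_of_column_eq hij.ne (fun k => ?_)
        simp [hdij]
      · intro c hc
        by_contra hne
        exact hst (Aq_St t n _ d c (mem_S.1 hc).2 (left_ne_zero_of_mul hne))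
  rw [Finset.sum_congr rfl h1]
  have h2 : ∀ c' ∈ S (r + 1) n, ∑ d ∈ Om (r + 1) n,
      (∏ j : Fin r, Lk t (b j.castSucc) (b j.succ) (d j.castSucc)) *
        (nu t (b (Fin.last r)) (d (Fin.last r)) * ind R (d (Fin.last r) ≤ H)) *
        Aq t n (r + 1) d c' =
      ∑ c ∈ S (r + 1) n, Aq t n (r + 1) b c * (Nk t c (ini c') *
      (nu t (c (Fin.last r)) (c' (Fin.last r)) * ind R (c' (Fin.last r) ≤ H))) := by
    intro c' hc'
    have hcm := mem_S.1 hc'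
    trans (nu t (b (Fin.last r)) (c' (Fin.last r)) * ind R (c' (Fin.last r) ≤ H)) *
      ∑ d ∈ box b, Aq t n r d (ini c')
    · rw [← id3 t n r b (ini c') hb (S_sub_Om (ini_mem_S hc')), sum_Om_snoc, Finset.mul_sum]
      refine Finset.sum_congr rfl fun d _ => ?_
      simp only [Aq_succ, sn_last, ini_sn, sn_castSucc]
      rw [Finset.sum_eq_single (c' (Fin.last r))]
      · rw [if_pos rfl]; ring
      · intro x _ hx
        rw [if_neg hx, mul_zero]
      · intro hnot
        exact absurd (Finset.mem_Icc.2 (hcm.1 _)) hnot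
    · rw [← id2 t n r b (ini c') hb (ini_mem_S hc'), Finset.mul_sum]
      refine Finset.sum_congr rfl fun c _ => ?_
      by_cases h0 : Aq t n (r + 1) b c = 0
      · rw [h0]; ring
      · rw [Aq_last _ _ _ _ _ h0]; ring
  trans T * ∑ c' ∈ S (r + 1) n, (∑ d ∈ Om (r + 1) n,
      (∏ j : Fin r, Lk t (b j.castSucc) (b j.succ) (d j.castSucc)) *
        (nu t (b (Fin.last r)) (d (Fin.last r)) * ind R (d (Fin.last r) ≤ H)) *
        Aq t n (r + 1) d c') * F c'
  · simp only [Finset.mul_sum, Finset.sum_mul]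
    rw [Finset.sum_comm]
    exact Finset.sum_congr rfl fun _ _ => Finset.sum_congr rfl fun _ _ => by ring
  · congr 1
    rw [Finset.sum_congr rfl fun c' hc' => by rw [h2 c' hc']]
    simp only [Finset.sum_mul]
    rw [Finset.sum_comm]
    refine Finset.sum_congr rfl fun c hc => ?_
    rw [hF c hc, Finset.mul_sum]
    rw [S, Finset.sum_filter_of_ne]
    · exact Finset.sum_congr rfl fun c' _ => by ring
    · intro c' _ hne
      have hne' := right_ne_zero_of_mul (left_ne_zero_of_mul hne)
      have y1 := Nk_ne (left_ne_zero_of_mul hne')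
      have y2 := nu_ne (left_ne_zero_of_mul (right_ne_zero_of_mul hne'))
      have hlow : ∀ j, c j ≤ c' j := by
        intro j; exact Fin.lastCases y2 (fun j => (y1 j).1) j
      rw [St_iff]
      intro i
      exact (y1 i).2.trans_le (hlow _)

theorem choose_diff (N s : ℕ) : ∀ (k a : ℕ), a + k ≤ N →
    ((N - a).choose (s + 1) : ℤ) - (N - (a + k)).choose (s + 1) =
      ∑ x ∈ Finset.Ico a (a + k), ((N - 1 - x).choose s : ℤ) := by
  intro k
  induction k with
  | zero => intro a _; simp
  | succ k ih =>
    intro a h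
    rw [← add_assoc, Finset.sum_Ico_succ_top (by omega), ← ih a (by omega)]
    have : N - (a + k) = (N - 1 - (a + k)) + 1 := by omega
    rw [this, Nat.choose_succ_succ, show N - (a + k + 1) = N - 1 - (a + k) by omega]
    push_cast; ring

/-- The binomial determinant. -/
def V (R : Type*) [CommRing R] (N : ℕ) {r : ℕ} (b : Fin r → ℕ) : R :=
  Matrix.det (Matrix.of fun i j : Fin r => (((N - b j).choose (r - 1 - i) : ℕ) : R))

theorem V_succ {N r : ℕ} (b : Fin (r + 1) → ℕ) (hb : St b) (hbN : ∀ i, b i ≤ N) :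
    V R N b = ∑ d ∈ box b, V R (N - 1) d := by
  rw [V, det_lastones]
  · have := det_multi (R := R) (r := r) (fun j : Fin r => Finset.Ico (b j.castSucc) (b j.succ))
      (fun _ _ => 1) (fun i x => (((N - 1 - x).choose (r - 1 - i) : ℕ) : R))
    simp only [Finset.prod_const_one, one_mul] at this
    rw [box]
    simp only [V]
    rw [← this]
    congr 1
    ext i j
    simp only [Matrix.of_apply]
    have hlt := hb _ _ j.castSucc_lt_succ
    have hi := i.2
    have h2 := choose_diff N (r - 1 - i) (b j.succ - b j.castSucc) (b j.castSucc)
      (by have := hbN j.succ; omega)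
    rw [show b j.castSucc + (b j.succ - b j.castSucc) = b j.succ by omega,
      show r - 1 - (i : ℕ) + 1 = r - i by omega] at h2
    have h3 := congrArg (Int.cast : ℤ → R) h2
    push_cast at h3
    simpa using h3
  · intro j; simp

theorem baseG (t : R) (n r0 : ℕ) (F : (r : ℕ) → (Fin r → ℕ) → R)
    (h0 : ∀ c, F 0 c = 1)
    (hF : ∀ r, r + 1 ≤ r0 → ∀ c ∈ S (r + 1) n, F (r + 1) c = ∑ c' ∈ Om r n, Nk t c c' * F r c') :
    ∀ r, r ≤ r0 → ∀ (N : ℕ) (b : Fin r → ℕ), b ∈ S r n → (∀ i, b i ≤ N) →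
      ∑ c ∈ S r n, Aq t n r b c * F r c = V R N b := by
  intro r
  induction r with
  | zero =>
    intro _ N b _ _
    have hS : S 0 n = {fun i => i.elim0} := by
      ext c; rw [mem_S, Finset.mem_singleton]
      constructor
      · intro _; funext i; exact i.elim0
      · intro _; exact ⟨fun i => i.elim0, fun i => i.elim0⟩
    simp [hS, Aq, h0, V]
  | succ r ih =>
    intro hr N b hb hbN
    have hb' := mem_S.1 hb
    rw [V_succ b hb'.2 hbN]
    have h1 : ∀ d ∈ box b, V R (N - 1) d = ∑ c ∈ S r n, Aq t n r d c * F r c := by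
      intro d hd
      rw [mem_box] at hd
      rw [ih (by omega) (N - 1) d]
      · rw [mem_S]
        refine ⟨fun i => ⟨(hb'.1 _).1.trans (hd i).1, (hd i).2.le.trans (hb'.1 _).2⟩, inter_St hd⟩
      · intro i
        have := (hd i).2
        have := hbN i.succ
        omega
    rw [Finset.sum_congr rfl h1, Finset.sum_comm]
    have h2 : ∀ c ∈ S (r + 1) n, Aq t n (r + 1) b c * F (r + 1) c =
        ∑ c' ∈ S r n, (Aq t n (r + 1) b c * Nk t c c') * F r c' := by
      intro c hc
      rw [hF r hr c hc, Finset.mul_sum, S, Finset.sum_filter_of_ne]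
      · exact Finset.sum_congr rfl fun c' _ => by ring
      · intro c' _ hne
        exact Nk_St' (right_ne_zero_of_mul (left_ne_zero_of_mul hne))
    rw [Finset.sum_congr rfl h2, Finset.sum_comm]
    refine Finset.sum_congr rfl fun c' hc' => ?_
    rw [← Finset.sum_mul, id2 t n r b c' hb hc', Finset.sum_mul]

theorem det_base (t : R) (n r : ℕ) (b : Fin r → ℕ) :
    Matrix.det (Matrix.of fun i j : Fin r =>
      ∑ s ∈ Finset.range r, (((r - 1 - i : ℕ).choose s : ℕ) : R) * t ^ s *
        (((n - b j).choose s : ℕ) : R)) = t ^ (r.choose 2) * V R n b := by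
  let T : Matrix (Fin r) (Fin r) R := Matrix.of fun i k =>
    (((r - 1 - i : ℕ).choose (r - 1 - k : ℕ) : ℕ) : R) * t ^ (r - 1 - k : ℕ)
  have hT : T.det = t ^ (r.choose 2) := by
    rw [Matrix.det_of_upperTriangular]
    · simp only [T, Matrix.of_apply, Nat.choose_self, Nat.cast_one, one_mul]
      rw [Finset.prod_pow_eq_pow_sum]
      congr 1
      rw [Fin.sum_univ_eq_sum_range (fun k => r - 1 - k), Finset.sum_range_reflect (fun k => k),
        Finset.sum_range_id, Nat.choose_two_right]
    · intro i j hij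
      have hij' : (j : ℕ) < i := hij
      have := i.2
      simp only [T, Matrix.of_apply]
      rw [Nat.choose_eq_zero_of_lt (by omega)]
      simp
  rw [V, ← hT, ← Matrix.det_mul]
  congr 1
  ext i j
  rw [Matrix.mul_apply]
  simp only [Matrix.of_apply, T]
  rw [Fin.sum_univ_eq_sum_range (fun k => (((r - 1 - i : ℕ).choose (r - 1 - k : ℕ) : ℕ) : R) *
    t ^ (r - 1 - k : ℕ) * (((n - b j).choose (r - 1 - k) : ℕ) : R))]
  rw [Finset.sum_range_reflect (fun k => (((r - 1 - i : ℕ).choose k : ℕ) : R) *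
    t ^ k * (((n - b j).choose k : ℕ) : R))]

/-- single-path closed form step -/
theorem closed_step (t : R) (n k N N' : ℕ) (b : ℕ) (hb : 1 ≤ b) (hbn : b ≤ n)
    (hN : k < N) (hN' : k + 1 < N') :
    ∑ x ∈ Finset.Icc 1 n, nu t b x *
      ∑ s ∈ Finset.range N, ((k.choose s : ℕ) : R) * t ^ s * (((n - x).choose s : ℕ) : R) =
    ∑ s ∈ Finset.range N', (((k + 1).choose s : ℕ) : R) * t ^ s * (((n - b).choose s : ℕ) : R) := by
  have hshr : ∀ (K M : ℕ) (f : ℕ → R), K < M → ∑ s ∈ Finset.range M, ((K.choose s : ℕ) : R) * f s =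
      ∑ s ∈ Finset.range (K + 1), ((K.choose s : ℕ) : R) * f s := by
    intro K M f hKM
    refine (Finset.sum_subset (Finset.range_subset_range.2 hKM) ?_).symm
    intro s _ hs
    rw [Finset.mem_range] at hs
    rw [Nat.choose_eq_zero_of_lt (by omega)]; simp
  simp only [mul_assoc]
  rw [hshr _ _ (fun s => t ^ s * (((n - b).choose s : ℕ) : R)) hN']
  simp only [fun x => hshr k N (fun s => t ^ s * (((n - x).choose s : ℕ) : R)) hN]
  have hsum : ∀ s, ∑ x ∈ Finset.Icc 1 n, nu t b x * (((n - x).choose s : ℕ) : R) =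
      (((n - b).choose s : ℕ) : R) + t * (((n - b).choose (s + 1) : ℕ) : R) := by
    intro s
    rw [← Finset.sum_subset (s₁ := Finset.Icc b n) (fun x hx => by
        rw [Finset.mem_Icc] at *; omega) (fun x hx hx' => by
        rw [Finset.mem_Icc] at *
        rw [nu, if_neg (by omega), if_neg (by omega), zero_mul])]
    rw [← Finset.add_sum_Ioc_eq_sum_Icc hbn]
    congr 1
    · simp [nu]
    · have h2 := choose_diff n s (n - b) b (by omega)
      rw [show b + (n - b) = n by omega] at h2
      have h3 := congrArg (Int.cast : ℤ → R) h2
      push_cast at h3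
      simp only [Nat.sub_self, Nat.choose_zero_succ, Nat.cast_zero, sub_zero] at h3
      rw [h3, Finset.mul_sum]
      refine (Finset.sum_bij' (fun x _ => x + 1) (fun x _ => x - 1) ?_ ?_ ?_ ?_ ?_).symm
      · intro x hx; rw [Finset.mem_Ico] at hx; rw [Finset.mem_Ioc]; omega
      · intro x hx; rw [Finset.mem_Ioc] at hx; rw [Finset.mem_Ico]; omega
      · intro x _; simp
      · intro x hx; rw [Finset.mem_Ioc] at hx; omega
      · intro x hx; rw [Finset.mem_Ico] at hx
        rw [nu, if_neg (by omega), if_pos (by omega), show n - (x + 1) = n - 1 - x by omega]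
  have hswap : ∑ x ∈ Finset.Icc 1 n, nu t b x *
      ∑ s ∈ Finset.range (k + 1), ((k.choose s : ℕ) : R) * (t ^ s * (((n - x).choose s : ℕ) : R)) =
      ∑ s ∈ Finset.range (k + 1), ((k.choose s : ℕ) : R) * t ^ s *
        ((((n - b).choose s : ℕ) : R) + t * (((n - b).choose (s + 1) : ℕ) : R)) := by
    simp only [← hsum, Finset.mul_sum]
    rw [Finset.sum_comm]
    exact Finset.sum_congr rfl fun _ _ => Finset.sum_congr rfl fun _ _ => by ring
  rw [hswap, Finset.sum_range_succ' _ (k + 1)]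
  simp only [Nat.choose_succ_succ k, mul_add, Finset.sum_add_distrib, Nat.cast_add, add_mul]
  rw [add_comm, add_assoc]
  congr 1
  · exact Finset.sum_congr rfl fun _ _ => by ring
  · rw [Finset.sum_range_succ' _ k, Finset.sum_range_succ _ k]
    simp [mul_assoc]

end CH

namespace CH

/-- horizontal segment in row `k` -/
def seg (k b d : ℕ) : Finset (ℕ × ℕ) := (Finset.Icc b d).image (fun j => (k, j))

theorem mem_seg {k b d : ℕ} {p : ℕ × ℕ} : p ∈ seg k b d ↔ p.1 = k ∧ b ≤ p.2 ∧ p.2 ≤ d := by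
  rcases p with ⟨i, j⟩
  simp only [seg, Finset.mem_image, Finset.mem_Icc, Prod.mk.injEq]
  constructor
  · rintro ⟨x, hx, rfl, rfl⟩; exact ⟨rfl, hx⟩
  · rintro ⟨rfl, hx⟩; exact ⟨j, hx, rfl, rfl⟩

theorem mk_mem_seg {k b d j : ℕ} (h1 : b ≤ j) (h2 : j ≤ d) : (k, j) ∈ seg k b d :=
  mem_seg.2 ⟨rfl, h1, h2⟩

theorem isPath_base {n a b : ℕ} {h : ℕ → ℕ} (ha : 1 ≤ a) (hb : 1 ≤ b) (hbn : b ≤ n) (hn : n ≤ h a)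
    (C : Finset (ℕ × ℕ)) :
    IsPath (ladder a n h) (a, n) (a, b) C ↔ C = seg a b n := by
  constructor
  · rintro ⟨h1, h2, h3, h4, h5, h6⟩
    ext ⟨i, j⟩
    rw [mem_seg]
    constructor
    · intro hx
      have := h4 _ hx
      simp only [ple] at this ⊢
      omega
    · rintro ⟨e1, e2, e3⟩
      simp only at e1 e2 e3
      subst e1
      refine h6 _ ?_ ?_ ?_ ?_
      · simp only [ladder, Set.mem_ofPred_eq]; omega
      · simp only [ple]; omega
      · simp only [ple]; omega
      · intro x hx
        have := h4 _ hx
        simp only [ple] at this ⊢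
        omega
  · rintro rfl
    refine ⟨?_, ?_, ?_, ?_, ?_, ?_⟩
    · rintro ⟨i, j⟩ hx
      rw [Finset.mem_coe, mem_seg] at hx
      simp only [ladder, Set.mem_ofPred_eq] at *
      obtain ⟨rfl, h2, h3⟩ := hx
      omega
    · exact mk_mem_seg (by omega) (by omega)
    · exact mk_mem_seg (by omega) (by omega)
    · intro x hx; rw [mem_seg] at hx; simp only [ple]; omega
    · intro x hx y hy; rw [mem_seg] at hx hy; simp only [ple]; omega
    · intro z hz h1 h2 _
      simp only [ple] at h1 h2
      rw [mem_seg]; omega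

theorem isPath_succ {m n a b : ℕ} {h : ℕ → ℕ} (hanti : Antitone h) (ha : 1 ≤ a) (ham : a ≤ m)
    (hb : 1 ≤ b) (C : Finset (ℕ × ℕ)) :
    IsPath (ladder (m + 1) n h) (a, n) (m + 1, b) C ↔
      ∃ d, b ≤ d ∧ d ≤ n ∧ d ≤ h (m + 1) ∧ ∃ C', IsPath (ladder m n h) (a, n) (m, d) C' ∧
        seg (m + 1) b d ∪ C' = C := by
  have hh : h (m + 1) ≤ h m := hanti (Nat.le_succ m)
  constructor
  · rintro ⟨h1, h2, h3, h4, h5, h6⟩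
    have hne : (C.filter (fun p => p.1 = m + 1)).Nonempty := ⟨_, Finset.mem_filter.2 ⟨h3, rfl⟩⟩
    obtain ⟨p, hp, hmax⟩ := Finset.exists_max_image _ (fun p : ℕ × ℕ => p.2) hne
    obtain ⟨i, d⟩ := p
    rw [Finset.mem_filter] at hp
    obtain ⟨hpC, hpi⟩ := hp
    simp only at hpi
    subst hpi
    have hmax' : ∀ j, (m + 1, j) ∈ C → j ≤ d := fun j hj =>
      hmax (m + 1, j) (Finset.mem_filter.2 ⟨hj, rfl⟩)
    have hdY := h1 hpC
    simp only [ladder, Set.mem_ofPred_eq] at hdY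
    have hbd : b ≤ d := hmax' b h3
    have hup : ∀ x ∈ C, x.1 ≤ m → d ≤ x.2 := by
      intro x hx hxm
      rcases h5 x hx _ hpC with hle | hle
      · simp only [ple] at hle; omega
      · simp only [ple] at hle; omega
    have hrow : ∀ j, b ≤ j → j ≤ d → (m + 1, j) ∈ C := by
      intro j hj1 hj2
      refine h6 _ ?_ ?_ ?_ ?_
      · simp only [ladder, Set.mem_ofPred_eq]; omega
      · simp only [ple]; omega
      · simp only [ple]; omega
      · intro x hx
        have q1 := h4 x hx
        have q2 := hup x hx
        simp only [ple] at *
        omega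
    have hmd : (m, d) ∈ C := by
      refine h6 _ ?_ ?_ ?_ ?_
      · simp only [ladder, Set.mem_ofPred_eq]; omega
      · simp only [ple]; omega
      · simp only [ple]; omega
      · intro x hx
        have q1 := h4 x hx
        have q2 := hup x hx
        by_cases hxm : x.1 = m + 1
        · have q3 := hmax' x.2 (by rw [← hxm]; exact hx)
          simp only [ple] at *
          omega
        · simp only [ple] at *
          omega
    refine ⟨d, hbd, by omega, by omega, C.filter (fun p => p.1 ≤ m), ⟨?_, ?_, ?_, ?_, ?_, ?_⟩, ?_⟩
    · intro x hx
      rw [Finset.mem_coe, Finset.mem_filter] at hx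
      have := h1 hx.1
      simp only [ladder, Set.mem_ofPred_eq] at *
      omega
    · exact Finset.mem_filter.2 ⟨h2, ham⟩
    · exact Finset.mem_filter.2 ⟨hmd, le_rfl⟩
    · intro x hx
      rw [Finset.mem_filter] at hx
      have q1 := h4 x hx.1
      have q2 := hup x hx.1 hx.2
      simp only [ple] at *
      omega
    · intro x hx y hy
      rw [Finset.mem_filter] at hx hy
      exact h5 x hx.1 y hy.1
    · intro z hz z1 z2 z3
      rw [Finset.mem_filter]
      have hzm : z.1 ≤ m := by simp only [ple] at z1; exact z1.1
      refine ⟨h6 z ?_ ?_ z2 ?_, hzm⟩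
      · simp only [ladder, Set.mem_ofPred_eq] at *; omega
      · simp only [ple] at *; omega
      · intro x hx
        by_cases hxm : x.1 ≤ m
        · exact z3 x (Finset.mem_filter.2 ⟨hx, hxm⟩)
        · have q1 := h4 x hx
          have : x.1 = m + 1 := by simp only [ple] at q1; omega
          have q3 := hmax' x.2 (by rw [← this]; exact hx)
          simp only [ple] at *
          omega
    · ext x
      rw [Finset.mem_union, mem_seg, Finset.mem_filter]
      constructor
      · rintro (⟨q1, q2, q3⟩ | q)
        · have := hrow x.2 q2 q3
          rw [← q1] at this; exact this
        · exact q.1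
      · intro hx
        by_cases hxm : x.1 ≤ m
        · exact Or.inr ⟨hx, hxm⟩
        · have q1 := h4 x hx
          have e : x.1 = m + 1 := by simp only [ple] at q1; omega
          have q3 := hmax' x.2 (by rw [← e]; exact hx)
          simp only [ple] at q1
          exact Or.inl ⟨e, q1.1.2, q3⟩
  · rintro ⟨d, hbd, hdn, hdh, C', ⟨h1, h2, h3, h4, h5, h6⟩, rfl⟩
    refine ⟨?_, ?_, ?_, ?_, ?_, ?_⟩
    · intro x hx
      rw [Finset.mem_coe, Finset.mem_union, mem_seg] at hx
      rcases hx with ⟨q1, q2, q3⟩ | q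
      · simp only [ladder, Set.mem_ofPred_eq]; rw [q1]; omega
      · have := h1 q
        simp only [ladder, Set.mem_ofPred_eq] at *; omega
    · exact Finset.mem_union_right _ h2
    · refine Finset.mem_union_left _ ?_; exact mk_mem_seg (by omega) (by omega)
    · intro x hx
      rw [Finset.mem_union, mem_seg] at hx
      rcases hx with ⟨q1, q2, q3⟩ | q
      · simp only [ple]; omega
      · have := h4 x q
        simp only [ple] at *; omega
    · intro x hx y hy
      rw [Finset.mem_union, mem_seg] at hx hy
      rcases hx with hx | hx <;> rcases hy with hy | hy
      · simp only [ple]; omega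
      · have := h4 y hy
        simp only [ple] at *; omega
      · have := h4 x hx
        simp only [ple] at *; omega
      · exact h5 x hx y hy
    · intro z hz z1 z2 z3
      rw [Finset.mem_union, mem_seg]
      by_cases hzm : z.1 ≤ m
      · right
        have q := z3 (m + 1, d) (by exact Finset.mem_union_left _ (mk_mem_seg (by omega) (by omega)))
        refine h6 z ?_ ?_ z2 (fun x hx => z3 x (Finset.mem_union_right _ hx))
        · simp only [ladder, Set.mem_ofPred_eq] at *; omega
        · simp only [ple] at *; omega
      · left
        have q := z3 (m, d) (Finset.mem_union_right _ h3)
        simp only [ple] at *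
        omega

theorem isPath_row {m n a d : ℕ} {h : ℕ → ℕ} {C : Finset (ℕ × ℕ)}
    (hC : IsPath (ladder m n h) (a, n) (m, d) C) {x : ℕ × ℕ} (hx : x ∈ C) :
    1 ≤ x.1 ∧ x.1 ≤ m ∧ 1 ≤ x.2 ∧ x.2 ≤ n ∧ d ≤ x.2 := by
  have h1 := hC.1 hx
  have h2 := hC.2.2.2.1 x hx
  simp only [ladder, Set.mem_ofPred_eq, ple] at h1 h2
  omega

theorem corners_seg {a b n : ℕ} (ha : 1 ≤ a) : cornersCount (seg a b n) = 0 := by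
  rw [cornersCount, Finset.card_eq_zero, Finset.filter_eq_empty_iff]
  rintro x hx ⟨h1, _⟩
  rw [mem_seg] at hx h1
  simp only at h1
  omega

theorem corners_union {m n a b d : ℕ} {h : ℕ → ℕ} {C : Finset (ℕ × ℕ)} (hb : 1 ≤ b) (hbd : b ≤ d)
    (hC : IsPath (ladder m n h) (a, n) (m, d) C) :
    cornersCount (seg (m + 1) b d ∪ C) = (if b < d then 1 else 0) + cornersCount C := by
  have hsub : ∀ i j : ℕ, i ≤ m → ((i, j) ∈ seg (m + 1) b d ∪ C ↔ (i, j) ∈ C) := by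
    intro i j hi
    rw [Finset.mem_union, mem_seg]; simp only
    constructor
    · rintro (h | h)
      · omega
      · exact h
    · exact Or.inr
  have hmd : (m, d) ∈ C := hC.2.2.1
  rw [cornersCount, Finset.filter_union, Finset.card_union_of_disjoint]
  · congr 1
    · have : (seg (m + 1) b d).filter (fun p => (p.1 - 1, p.2) ∈ seg (m + 1) b d ∪ C ∧
          (p.1, p.2 - 1) ∈ seg (m + 1) b d ∪ C) = if b < d then {(m + 1, d)} else ∅ := by
        ext ⟨i, j⟩
        rw [Finset.mem_filter, mem_seg]
        simp only
        constructor
        · rintro ⟨⟨rfl, q2, q3⟩, q4, q5⟩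
          simp only [Nat.add_sub_cancel] at q4
          rw [hsub _ _ le_rfl] at q4
          have r1 := isPath_row hC q4
          simp only at r1
          rw [Finset.mem_union, mem_seg] at q5
          rcases q5 with q5 | q5
          · simp only at q5
            rw [if_pos (by omega), Finset.mem_singleton]
            congr 1
            omega
          · have r2 := isPath_row hC q5
            simp only at r2; omega
        · intro hx
          split_ifs at hx with hlt
          · rw [Finset.mem_singleton, Prod.mk.injEq] at hx
            obtain ⟨rfl, rfl⟩ := hx
            refine ⟨by omega, ?_, ?_⟩
            · exact Finset.mem_union_right _ hmd
            · refine Finset.mem_union_left _ ?_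
              exact mk_mem_seg (by omega) (by omega)
          · simp at hx
      rw [this]
      split_ifs <;> simp
    · rw [cornersCount]
      congr 1
      refine Finset.filter_congr fun x hx => ?_
      have r := isPath_row hC hx
      rw [hsub _ _ (by omega), hsub _ _ (by omega)]
  · rw [Finset.disjoint_left]
    intro x hx hx'
    rw [Finset.mem_filter] at hx hx'
    have r := isPath_row hC hx'.1
    have := mem_seg.1 hx.1
    omega

theorem seg_union_inj {m n a b d d' : ℕ} {h : ℕ → ℕ} {C C' : Finset (ℕ × ℕ)} (hbd : b ≤ d)
    (hbd' : b ≤ d')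
    (hC : IsPath (ladder m n h) (a, n) (m, d) C) (hC' : IsPath (ladder m n h) (a, n) (m, d') C')
    (heq : seg (m + 1) b d ∪ C = seg (m + 1) b d' ∪ C') : d = d' ∧ C = C' := by
  have key : ∀ x : ℕ × ℕ, x ∈ seg (m + 1) b d ∪ C ↔ x ∈ seg (m + 1) b d' ∪ C' := by
    intro x; rw [heq]
  constructor
  · have k1 := key (m + 1, d)
    have k2 := key (m + 1, d')
    rw [Finset.mem_union, Finset.mem_union, mem_seg, mem_seg] at k1 k2
    have a1 : (m + 1, d) ∉ C' := fun hx => by have := isPath_row hC' hx; simp only at this; omega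
    have a2 : (m + 1, d') ∉ C := fun hx => by have := isPath_row hC hx; simp only at this; omega
    have b1 : (m + 1, d) ∈ seg (m + 1) b d' := by
      rw [mem_seg]
      exact ((k1.1 (Or.inl ⟨rfl, hbd, le_rfl⟩)).resolve_right a1)
    have b2 : (m + 1, d') ∈ seg (m + 1) b d := by
      rw [mem_seg]
      exact ((k2.2 (Or.inl ⟨rfl, hbd', le_rfl⟩)).resolve_right a2)
    rw [mem_seg] at b1 b2
    simp only at b1 b2
    omega
  · ext x
    constructor
    · intro hx
      have r := isPath_row hC hx
      rcases Finset.mem_union.1 ((key x).1 (Finset.mem_union_right _ hx)) with q | q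
      · rw [mem_seg] at q; omega
      · exact q
    · intro hx
      have r := isPath_row hC' hx
      rcases Finset.mem_union.1 ((key x).2 (Finset.mem_union_right _ hx)) with q | q
      · rw [mem_seg] at q; omega
      · exact q

open Classical in
/-- The finite set of paths. -/
noncomputable def P (h : ℕ → ℕ) (n m a b : ℕ) : Finset (Finset (ℕ × ℕ)) :=
  ((Finset.range (m + 1) ×ˢ Finset.range (n + 1)).powerset).filter
    (IsPath (ladder m n h) (a, n) (m, b))

theorem mem_P {h : ℕ → ℕ} {n m a b : ℕ} {C : Finset (ℕ × ℕ)} :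
    C ∈ P h n m a b ↔ IsPath (ladder m n h) (a, n) (m, b) C := by
  classical
  rw [P, Finset.mem_filter, Finset.mem_powerset]
  refine ⟨fun h => h.2, fun hC => ⟨fun x hx => ?_, hC⟩⟩
  have := isPath_row hC hx
  rw [Finset.mem_product, Finset.mem_range, Finset.mem_range]
  omega

theorem corners_le {h : ℕ → ℕ} (hanti : Antitone h) {n a : ℕ} (ha : 1 ≤ a) (hn : n ≤ h a) :
    ∀ (k b : ℕ) (C : Finset (ℕ × ℕ)), 1 ≤ b → b ≤ n → C ∈ P h n (a + k) a b →
      cornersCount C ≤ k := by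
  intro k
  induction k with
  | zero =>
    intro b C hb hbn hC
    rw [mem_P] at hC
    rw [(isPath_base ha hb hbn hn C).1 hC, corners_seg ha]
  | succ k ih =>
    intro b C hb hbn hC
    rw [mem_P] at hC
    obtain ⟨d, h1, h2, h3, C', hC', rfl⟩ :=
      (isPath_succ (m := a + k) hanti ha (by omega) hb C).1 hC
    rw [corners_union hb h1 hC']
    have := ih d C' (by omega) h2 (mem_P.2 hC')
    split_ifs <;> omega

theorem sum_bij_sigma {α β γ M : Type*} [AddCommMonoid M] (P : Finset α) (D : Finset β)
    (Q : β → Finset γ) (e : β → γ → α)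
    (maps : ∀ d ∈ D, ∀ x ∈ Q d, e d x ∈ P)
    (inj : ∀ d ∈ D, ∀ x ∈ Q d, ∀ d' ∈ D, ∀ x' ∈ Q d', e d x = e d' x' → d = d' ∧ x = x')
    (surj : ∀ y ∈ P, ∃ d ∈ D, ∃ x ∈ Q d, e d x = y) (f : α → M) :
    ∑ y ∈ P, f y = ∑ d ∈ D, ∑ x ∈ Q d, f (e d x) := by
  rw [Finset.sum_sigma']
  symm
  refine Finset.sum_bij (fun p _ => e p.1 p.2) ?_ ?_ ?_ ?_
  · rintro ⟨d, x⟩ hp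
    rw [Finset.mem_sigma] at hp
    exact maps d hp.1 x hp.2
  · rintro ⟨d, x⟩ hp ⟨d', x'⟩ hp' heq
    rw [Finset.mem_sigma] at hp hp'
    obtain ⟨h1, h2⟩ := inj d hp.1 x hp.2 d' hp'.1 x' hp'.2 heq
    subst h1; subst h2; rfl
  · intro y hy
    obtain ⟨d, hd, x, hx, h⟩ := surj y hy
    exact ⟨⟨d, x⟩, Finset.mem_sigma.2 ⟨hd, hx⟩, h⟩
  · intros; rfl

theorem sum_bij_pi {ι α β γ M : Type*} [Fintype ι] [DecidableEq ι] [AddCommMonoid M]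
    (P : ι → Finset α) (D : ι → Finset β)
    (Q : ι → β → Finset γ) (e : ι → β → γ → α)
    (maps : ∀ i, ∀ d ∈ D i, ∀ x ∈ Q i d, e i d x ∈ P i)
    (inj : ∀ i, ∀ d ∈ D i, ∀ x ∈ Q i d, ∀ d' ∈ D i, ∀ x' ∈ Q i d',
      e i d x = e i d' x' → d = d' ∧ x = x')
    (surj : ∀ i, ∀ y ∈ P i, ∃ d ∈ D i, ∃ x ∈ Q i d, e i d x = y) (f : (ι → α) → M) :
    ∑ y ∈ Fintype.piFinset P, f y = ∑ d ∈ Fintype.piFinset D,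
      ∑ x ∈ Fintype.piFinset (fun i => Q i (d i)), f (fun i => e i (d i) (x i)) := by
  refine sum_bij_sigma (Fintype.piFinset P) (Fintype.piFinset D)
    (fun d => Fintype.piFinset (fun i => Q i (d i))) (fun d x i => e i (d i) (x i)) ?_ ?_ ?_ f
  · intro d hd x hx
    rw [Fintype.mem_piFinset] at *
    exact fun i => maps i _ (hd i) _ (hx i)
  · intro d hd x hx d' hd' x' hx' heq
    rw [Fintype.mem_piFinset] at *
    have := fun i => inj i _ (hd i) _ (hx i) _ (hd' i) _ (hx' i) (congrFun heq i)
    exact ⟨funext fun i => (this i).1, funext fun i => (this i).2⟩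
  · intro y hy
    rw [Fintype.mem_piFinset] at hy
    choose d hd x hx h using fun i => surj i _ (hy i)
    exact ⟨d, Fintype.mem_piFinset.2 hd, x, Fintype.mem_piFinset.2 hx, funext h⟩

end CH

namespace CH

variable {R : Type*} [CommRing R]

/-- single path generating function -/
noncomputable def Wp (t : R) (h : ℕ → ℕ) (n m a b : ℕ) : R :=
  ∑ C ∈ P h n m a b, t ^ cornersCount C

/-- range of exit columns -/
def Dr (h : ℕ → ℕ) (n m b : ℕ) : Finset ℕ := Finset.Icc b (min n (h (m + 1)))

theorem mem_Dr {h : ℕ → ℕ} {n m b d : ℕ} : d ∈ Dr h n m b ↔ b ≤ d ∧ d ≤ n ∧ d ≤ h (m + 1) := by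
  simp [Dr]

theorem nu_eq (t : R) {b d : ℕ} (hbd : b ≤ d) : nu t b d = t ^ (if b < d then 1 else 0) := by
  unfold nu
  split_ifs <;> first | omega | simp

theorem Wp_succ (t : R) {h : ℕ → ℕ} (hanti : Antitone h) {n m a b : ℕ} (ha : 1 ≤ a) (ham : a ≤ m)
    (hb : 1 ≤ b) :
    Wp t h n (m + 1) a b =
      ∑ x ∈ Finset.Icc 1 n, nu t b x * ind R (x ≤ h (m + 1)) * Wp t h n m a x := by
  rw [Wp, sum_bij_sigma (P h n (m + 1) a b) (Dr h n m b) (fun d => P h n m a d)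
    (fun d C => seg (m + 1) b d ∪ C)]
  · rw [← Finset.sum_subset (s₁ := Dr h n m b) (s₂ := Finset.Icc 1 n)]
    · refine Finset.sum_congr rfl fun d hd => ?_
      rw [mem_Dr] at hd
      rw [ind_true hd.2.2, mul_one, Wp, Finset.mul_sum]
      refine Finset.sum_congr rfl fun C hC => ?_
      rw [corners_union hb hd.1 (mem_P.1 hC), pow_add, nu_eq t hd.1]
    · intro x hx; rw [mem_Dr] at hx; rw [Finset.mem_Icc]; omega
    · intro x hx hx'
      by_contra hne
      apply hx'
      rw [mem_Dr]
      rw [Finset.mem_Icc] at hx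
      exact ⟨nu_ne (left_ne_zero_of_mul (left_ne_zero_of_mul hne)), hx.2,
        ind_ne (right_ne_zero_of_mul (left_ne_zero_of_mul hne))⟩
  · intro d hd C hC
    rw [mem_Dr] at hd
    rw [mem_P] at *
    exact (isPath_succ hanti ha ham hb _).2 ⟨d, hd.1, hd.2.1, hd.2.2, C, hC, rfl⟩
  · intro d hd C hC d' hd' C' hC' heq
    exact seg_union_inj (mem_Dr.1 hd).1 (mem_Dr.1 hd').1 (mem_P.1 hC) (mem_P.1 hC') heq
  · intro C hC
    obtain ⟨d, h1, h2, h3, C', hC', rfl⟩ := (isPath_succ hanti ha ham hb C).1 (mem_P.1 hC)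
    exact ⟨d, mem_Dr.2 ⟨h1, h2, h3⟩, C', mem_P.2 hC', rfl⟩

theorem P_base {h : ℕ → ℕ} {n a b : ℕ} (ha : 1 ≤ a) (hb : 1 ≤ b) (hbn : b ≤ n) (hn : n ≤ h a) :
    P h n a a b = {seg a b n} := by
  ext C
  rw [mem_P, isPath_base ha hb hbn hn, Finset.mem_singleton]

theorem Wp_base (t : R) {h : ℕ → ℕ} {n a b : ℕ} (ha : 1 ≤ a) (hb : 1 ≤ b) (hbn : b ≤ n)
    (hn : n ≤ h a) : Wp t h n a a b = 1 := by
  rw [Wp, P_base ha hb hbn hn, Finset.sum_singleton, corners_seg ha, pow_zero]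

theorem Wp_closed (t : R) {h : ℕ → ℕ} (hanti : Antitone h) {n a : ℕ} (ha : 1 ≤ a) :
    ∀ (k b N : ℕ), n ≤ h (a + k) → 1 ≤ b → b ≤ n → k < N → Wp t h n (a + k) a b =
      ∑ s ∈ Finset.range N, ((k.choose s : ℕ) : R) * t ^ s * (((n - b).choose s : ℕ) : R) := by
  intro k
  induction k with
  | zero =>
    intro b N hn hb hbn hN
    rw [add_zero] at *
    rw [Wp_base t ha hb hbn hn]
    obtain ⟨N, rfl⟩ : ∃ M, N = M + 1 := ⟨N - 1, by omega⟩
    rw [Finset.sum_range_succ']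
    simp
  | succ k ih =>
    intro b N hn hb hbn hN
    rw [← closed_step t n k (k + 1) N b hb hbn (by omega) hN, ← add_assoc,
      Wp_succ t hanti ha (by omega) hb]
    refine Finset.sum_congr rfl fun x hx => ?_
    rw [Finset.mem_Icc] at hx
    rw [ind_true (show x ≤ h (a + k + 1) from hx.2.trans hn), mul_one,
      ih x (k + 1) (hn.trans (hanti (by omega))) hx.1 hx.2 (by omega)]

/-- pairwise disjointness -/
abbrev Dj {r : ℕ} (C : Fin r → Finset (ℕ × ℕ)) : Prop := ∀ i j, i ≠ j → Disjoint (C i) (C j)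

/-- summand for tuples -/
def Fs (t : R) {r : ℕ} (C : Fin r → Finset (ℕ × ℕ)) : R :=
  ind R (Dj C) * t ^ (∑ i, cornersCount (C i))

/-- tuple generating function -/
noncomputable def FT (t : R) (h : ℕ → ℕ) (n m : ℕ) {r : ℕ} (c : Fin r → ℕ) : R :=
  ∑ C ∈ Fintype.piFinset (fun i : Fin r => P h n m ((i : ℕ) + 1) (c i)), Fs t C

theorem Dj_iff {r K : ℕ} {c e : Fin (r + 1) → ℕ} (C : Fin (r + 1) → Finset (ℕ × ℕ))
    (hc : St c) (hce : ∀ i, c i ≤ e i) (hC : ∀ i, ∀ x ∈ C i, x.1 < K) :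
    Dj (fun i => seg K (c i) (e i) ∪ C i) ↔
      (∀ i : Fin r, e i.castSucc < c i.succ) ∧ Dj C := by
  constructor
  · intro hD
    refine ⟨fun i => ?_, fun i j hij => ?_⟩
    · by_contra hlt
      have := hD i.castSucc i.succ i.castSucc_lt_succ.ne
      rw [Finset.disjoint_left] at this
      have h1 := (hc _ _ i.castSucc_lt_succ)
      exact this (a := (K, c i.succ)) (Finset.mem_union_left _ (mk_mem_seg h1.le (by omega)))
        (Finset.mem_union_left _ (mk_mem_seg le_rfl (hce _)))
    · exact Finset.disjoint_of_subset_left Finset.subset_union_right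
        (Finset.disjoint_of_subset_right Finset.subset_union_right (hD i j hij))
  · rintro ⟨h1, h2⟩
    have hcm : Monotone c := StrictMono.monotone (f := c) (fun i j hij => hc i j hij)
    have hlt : ∀ i j : Fin (r + 1), i < j → e i < c j := by
      intro i j hij
      have hi : (i : ℕ) < r := by have := j.2; have : (i : ℕ) < j := hij; omega
      have h3 := h1 ⟨i, hi⟩
      have h4 : c (Fin.succ ⟨i, hi⟩) ≤ c j := hcm (by
        rw [Fin.le_def]; simp only [Fin.val_succ]; exact hij)
      exact h3.trans_le h4
    intro i j hij
    rw [Finset.disjoint_left]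
    intro x hx hx'
    rw [Finset.mem_union, mem_seg] at hx hx'
    rcases hx with hx | hx <;> rcases hx' with hx' | hx'
    · rcases lt_or_gt_of_ne hij with hl | hl
      · have := hlt _ _ hl; omega
      · have := hlt _ _ hl; omega
    · have := hC j x hx'; omega
    · have := hC i x hx; omega
    · exact Finset.disjoint_left.1 (h2 i j hij) hx hx'

theorem ind_and (p q : Prop) [Decidable p] [Decidable q] : ind R (p ∧ q) = ind R p * ind R q := by
  unfold ind
  split_ifs <;> simp_all

theorem ind_congr {p q : Prop} [Decidable p] [Decidable q] (hpq : p ↔ q) : ind R p = ind R q := by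
  unfold ind
  split_ifs <;> simp_all

theorem prod_ind {r : ℕ} (p : Fin r → Prop) [∀ i, Decidable (p i)] :
    ∏ i, ind R (p i) = ind R (∀ i, p i) := by
  by_cases hp : ∀ i, p i
  · rw [ind_true hp, Finset.prod_eq_one]; intro i _; exact ind_true (hp i)
  · rw [ind_false hp]
    push Not at hp
    obtain ⟨i, hi⟩ := hp
    exact Finset.prod_eq_zero (Finset.mem_univ i) (ind_false hi)

theorem sum_pi_peel (_t : R) {h : ℕ → ℕ} (hanti : Antitone h) {n m r : ℕ} (hrm : r ≤ m)
    (c : Fin r → ℕ) (hc : ∀ i, 1 ≤ c i) (f : (Fin r → Finset (ℕ × ℕ)) → R) :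
    ∑ C ∈ Fintype.piFinset (fun i : Fin r => P h n (m + 1) ((i : ℕ) + 1) (c i)), f C =
      ∑ d ∈ Fintype.piFinset (fun i => Dr h n m (c i)),
        ∑ C ∈ Fintype.piFinset (fun i : Fin r => P h n m ((i : ℕ) + 1) (d i)),
          f (fun i => seg (m + 1) (c i) (d i) ∪ C i) := by
  refine sum_bij_pi (fun i : Fin r => P h n (m + 1) ((i : ℕ) + 1) (c i))
    (fun i => Dr h n m (c i)) (fun i d => P h n m ((i : ℕ) + 1) d)
    (fun i d C => seg (m + 1) (c i) d ∪ C) ?_ ?_ ?_ f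
  · intro i d hd C hC
    rw [mem_Dr] at hd
    rw [mem_P] at *
    exact (isPath_succ hanti (by omega) (by have := i.2; omega) (hc i) _).2
      ⟨d, hd.1, hd.2.1, hd.2.2, C, hC, rfl⟩
  · intro i d hd C hC d' hd' C' hC' heq
    exact seg_union_inj (mem_Dr.1 hd).1 (mem_Dr.1 hd').1 (mem_P.1 hC) (mem_P.1 hC') heq
  · intro i C hC
    obtain ⟨d, h1, h2, h3, C', hC', rfl⟩ :=
      (isPath_succ hanti (by omega) (by have := i.2; omega) (hc i) C).1 (mem_P.1 hC)
    exact ⟨d, mem_Dr.2 ⟨h1, h2, h3⟩, C', mem_P.2 hC', rfl⟩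

theorem FT_succ (t : R) {h : ℕ → ℕ} (hanti : Antitone h) {n m r : ℕ} (hrm : r + 1 ≤ m)
    (c : Fin (r + 1) → ℕ) (hc : c ∈ S (r + 1) n) :
    FT t h n (m + 1) c = ∑ c' ∈ Om (r + 1) n, Nk t c (ini c') *
      (nu t (c (Fin.last r)) (c' (Fin.last r)) * ind R (c' (Fin.last r) ≤ h (m + 1))) *
        FT t h n m c' := by
  have hc' := mem_S.1 hc
  rw [FT, sum_pi_peel t hanti hrm c (fun i => (hc'.1 i).1)]
  rw [← Finset.sum_subset (s₁ := Fintype.piFinset (fun i => Dr h n m (c i))) (s₂ := Om (r + 1) n)]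
  · refine Finset.sum_congr rfl fun d hd => ?_
    rw [Fintype.mem_piFinset] at hd
    simp only [mem_Dr] at hd
    rw [FT, Finset.mul_sum]
    refine Finset.sum_congr rfl fun C hC => ?_
    rw [Fintype.mem_piFinset] at hC
    simp only [mem_P] at hC
    rw [Fs, ind_congr (Dj_iff C hc'.2 (fun i => (hd i).1) (fun i x hx => by
      have := isPath_row (hC i) hx; omega)), ind_and,
      Finset.sum_congr rfl (fun i _ => corners_union (hc'.1 i).1 (hd i).1 (hC i)),
      Finset.sum_add_distrib, pow_add, ← Finset.prod_pow_eq_pow_sum,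
      Finset.prod_congr rfl (fun i _ => (nu_eq t (hd i).1).symm), Fin.prod_univ_castSucc,
      ind_true (hd (Fin.last r)).2.2, Nk, Finset.prod_mul_distrib, prod_ind, Fs]
    unfold ini
    ring
  · intro d hd
    rw [Fintype.mem_piFinset] at hd
    simp only [mem_Dr] at hd
    rw [mem_Om]
    intro i
    exact ⟨(hc'.1 i).1.trans (hd i).1, (hd i).2.1⟩
  · intro d hd hd'
    by_contra hne
    apply hd'
    have hne' := left_ne_zero_of_mul hne
    have y1 := Nk_ne (left_ne_zero_of_mul hne')
    have y2 := nu_ne (left_ne_zero_of_mul (right_ne_zero_of_mul hne'))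
    have y3 := ind_ne (right_ne_zero_of_mul (right_ne_zero_of_mul hne'))
    have hlow : ∀ j, c j ≤ d j := by
      intro j; exact Fin.lastCases y2 (fun j => (y1 j).1) j
    have hmono : Monotone d := by
      rw [Fin.monotone_iff_le_succ]
      intro i
      exact (y1 i).2.le.trans (hlow _)
    rw [Fintype.mem_piFinset]
    intro i
    rw [mem_Dr]
    exact ⟨hlow i, (mem_Om.1 hd i).2, (hmono (Fin.le_last i)).trans y3⟩

theorem sum_pi_snoc' {r : ℕ} {α M : Type*} [AddCommMonoid M] (s : Fin (r + 1) → Finset α)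
    (f : (Fin (r + 1) → α) → M) :
    ∑ d ∈ Fintype.piFinset s, f d =
      ∑ d ∈ Fintype.piFinset (fun i : Fin r => s i.castSucc), ∑ x ∈ s (Fin.last r),
        f (Fin.snoc (α := fun _ => α) d x) := by
  rw [← Finset.sum_product']
  refine (Finset.sum_bij' (fun p _ => Fin.snoc (α := fun _ => α) p.1 p.2)
    (fun d _ => ((fun i => d i.castSucc), d (Fin.last r))) ?_ ?_ ?_ ?_ ?_).symm
  · rintro ⟨d, x⟩ h
    simp only [Finset.mem_product, Fintype.mem_piFinset] at h ⊢
    intro i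
    refine Fin.lastCases ?_ (fun i => ?_) i
    · simpa using h.2
    · simpa using h.1 i
  · intro d h
    simp only [Finset.mem_product, Fintype.mem_piFinset] at h ⊢
    exact ⟨fun i => h _, h _⟩
  · rintro ⟨d, x⟩ h; simp
  · intro d h
    funext i
    refine Fin.lastCases ?_ (fun i => ?_) i <;> simp
  · intros; rfl

theorem FT_diag (t : R) {h : ℕ → ℕ} (hanti : Antitone h) {n r : ℕ} (hn : n ≤ h (r + 1))
    (c : Fin (r + 1) → ℕ) (hc : c ∈ S (r + 1) n) :
    FT t h n (r + 1) c = ∑ c' ∈ Om r n, Nk t c c' * FT t h n r c' := by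
  have hc' := mem_S.1 hc
  rw [FT, sum_pi_snoc']
  simp only [Fin.val_last, Fin.val_castSucc]
  rw [P_base (by omega) (hc'.1 _).1 (hc'.1 _).2 hn]
  simp only [Finset.sum_singleton]
  have := sum_pi_peel t hanti (n := n) (le_refl r) (fun i : Fin r => c i.castSucc)
    (fun i => (hc'.1 _).1) (fun C => Fs t (Fin.snoc (α := fun _ => Finset (ℕ × ℕ)) C
      (seg (r + 1) (c (Fin.last r)) n)))
  rw [this]
  rw [← Finset.sum_subset (s₁ := Fintype.piFinset (fun i : Fin r => Dr h n r (c i.castSucc)))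
    (s₂ := Om r n)]
  · refine Finset.sum_congr rfl fun d hd => ?_
    rw [Fintype.mem_piFinset] at hd
    simp only [mem_Dr] at hd
    rw [FT, Finset.mul_sum]
    refine Finset.sum_congr rfl fun C hC => ?_
    rw [Fintype.mem_piFinset] at hC
    simp only [mem_P] at hC
    have e1 : (Fin.snoc (α := fun _ => Finset (ℕ × ℕ))
        (fun i : Fin r => seg (r + 1) (c i.castSucc) (d i) ∪ C i)
        (seg (r + 1) (c (Fin.last r)) n) : Fin (r + 1) → Finset (ℕ × ℕ)) =
        fun i => seg (r + 1) (c i) (sn d n i) ∪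
          (Fin.snoc (α := fun _ => Finset (ℕ × ℕ)) C ∅ : Fin (r + 1) → Finset (ℕ × ℕ)) i := by
      funext i
      refine Fin.lastCases ?_ (fun i => ?_) i <;> simp
    have e2 : Dj (Fin.snoc (α := fun _ => Finset (ℕ × ℕ)) C ∅ : Fin (r + 1) → Finset (ℕ × ℕ)) ↔
        Dj C := by
      constructor
      · intro hD i j hij
        have := hD i.castSucc j.castSucc (by simpa using hij)
        simpa using this
      · intro hD i j
        refine Fin.lastCases ?_ (fun i => ?_) i <;> refine Fin.lastCases ?_ (fun j => ?_) j
        · intro hij; exact absurd rfl hij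
        · intro _; simp
        · intro _; simp
        · intro hij; simpa using hD i j (by simpa using hij)
    have e3 : ∑ i, cornersCount ((Fin.snoc (α := fun _ => Finset (ℕ × ℕ))
        (fun i : Fin r => seg (r + 1) (c i.castSucc) (d i) ∪ C i)
        (seg (r + 1) (c (Fin.last r)) n) : Fin (r + 1) → Finset (ℕ × ℕ)) i) =
        ∑ i : Fin r, (if c i.castSucc < d i then 1 else 0) + ∑ i, cornersCount (C i) := by
      rw [Fin.sum_univ_castSucc]
      simp only [Fin.snoc_castSucc, Fin.snoc_last]
      rw [corners_seg (by omega), add_zero, ← Finset.sum_add_distrib]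
      exact Finset.sum_congr rfl (fun i _ => corners_union (hc'.1 _).1 (hd i).1 (hC i))
    rw [Fs, e3, e1, ind_congr (Dj_iff _ hc'.2 _ _), ind_and, ind_congr e2,
      pow_add, ← Finset.prod_pow_eq_pow_sum,
      Finset.prod_congr rfl (fun i _ => (nu_eq t (hd i).1).symm),
      Nk, Finset.prod_mul_distrib, prod_ind, Fs]
    · simp only [sn_castSucc]
      ring
    · intro i
      refine Fin.lastCases ?_ (fun i => ?_) i
      · simpa using (hc'.1 _).2
      · simpa using (hd i).1
    · intro i
      refine Fin.lastCases ?_ (fun i => ?_) i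
      · simp
      · intro x hx
        simp only [Fin.snoc_castSucc] at hx
        have := isPath_row (hC i) hx
        omega
  · intro d hd
    rw [Fintype.mem_piFinset] at hd
    simp only [mem_Dr] at hd
    rw [mem_Om]
    intro i
    exact ⟨(hc'.1 _).1.trans (hd i).1, (hd i).2.1⟩
  · intro d hd hd'
    by_contra hne
    apply hd'
    have y1 := Nk_ne (left_ne_zero_of_mul hne)
    rw [Fintype.mem_piFinset]
    intro i
    rw [mem_Dr]
    have := (mem_Om.1 hd i).2
    exact ⟨(y1 i).1, this, this.trans hn⟩

/-- The main algebraic statement. -/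
theorem main_alg (t : R) {h : ℕ → ℕ} (hanti : Antitone h) {n r : ℕ} (hn : n ≤ h (r + 1)) :
    ∀ k, ∀ b ∈ S (r + 1) n, (∀ i, b i ≤ h (r + 1 + k)) →
      Matrix.det (Matrix.of fun i j : Fin (r + 1) =>
        Wp t h n (r + 1 + k) ((i : ℕ) + 1) (b j)) =
      t ^ ((r + 1).choose 2) * ∑ c ∈ S (r + 1) n, Aq t n (r + 1) b c * FT t h n (r + 1 + k) c := by
  intro k
  induction k with
  | zero =>
    intro b hb hbh
    have hb' := mem_S.1 hb
    rw [add_zero]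
    have := baseG t n (r + 1) (fun s c => FT t h n s c) (by intro c; simp [FT, Fs, ind])
      (fun s hs c hc => FT_diag t hanti (hn.trans (hanti hs)) c hc) (r + 1) le_rfl n b hb
      (fun i => (hb'.1 i).2)
    rw [this, ← det_base]
    congr 1
    ext i j
    simp only [Matrix.of_apply]
    have hi := i.2
    have h2 := Wp_closed t hanti (n := n) (a := (i : ℕ) + 1) (by omega) (r + 1 - 1 - i) (b j) (r + 1)
    rw [show (i : ℕ) + 1 + (r + 1 - 1 - i) = r + 1 by omega] at h2
    exact h2 hn (hb'.1 j).1 (hb'.1 j).2 (by omega)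
  | succ k ih =>
    intro b hb hbh
    exact step t _ (hanti (Nat.le_succ (r + 1 + k)))
      (fun (i : Fin (r + 1)) b => Wp t h n (r + 1 + k) ((i : ℕ) + 1) b)
      (fun (i : Fin (r + 1)) b => Wp t h n (r + 1 + k + 1) ((i : ℕ) + 1) b)
      (fun c => FT t h n (r + 1 + k) c) (fun c => FT t h n (r + 1 + k + 1) c)
      (fun i b hb1 _ _ => Wp_succ t hanti (by omega) (by have := i.2; omega) hb1)
      (fun c hc => FT_succ t hanti (by omega) c hc) ih b hb hbh

end CH

namespace CH

theorem ncard_sum {α : Type*} (F : Finset α) (g : α → ℕ) (N : ℕ) (hN : ∀ x ∈ F, g x < N) :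
    ∑ k ∈ Finset.range N, ((Set.ncard {x | x ∈ F ∧ g x = k} : ℕ) : ℚ[X]) * X ^ k =
      ∑ x ∈ F, (X : ℚ[X]) ^ g x := by
  classical
  rw [← Finset.sum_fiberwise_of_maps_to (s := F) (t := Finset.range N) (g := g)
    (fun x hx => Finset.mem_range.2 (hN x hx))]
  refine Finset.sum_congr rfl fun k _ => ?_
  have : {x | x ∈ F ∧ g x = k} = ((F.filter (fun x => g x = k) : Finset α) : Set α) := by
    ext x; simp
  rw [this, Set.ncard_coe_finset, Finset.sum_congr rfl (g := fun _ => (X : ℚ[X]) ^ k),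
    Finset.sum_const, nsmul_eq_mul]
  intro x hx
  rw [(Finset.mem_filter.1 hx).2]

theorem Wpoly_eq {h : ℕ → ℕ} (hanti : Antitone h) {n m a b N : ℕ} (ha : 1 ≤ a) (ham : a ≤ m)
    (hn : n ≤ h a) (hb : 1 ≤ b) (hbn : b ≤ n) (hN : m < N) :
    Wpoly (ladder m n h) (a, n) (m, b) N = Wp X h n m a b := by
  obtain ⟨k, rfl⟩ := Nat.exists_eq_add_of_le ham
  rw [Wp, ← ncard_sum (P h n (a + k) a b) cornersCount N]
  · simp only [Wpoly, pathCount, mem_P]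
  · intro C hC
    have := corners_le hanti ha hn k b C hb hbn hC
    omega

theorem WTpoly_eq {h : ℕ → ℕ} (hanti : Antitone h) {n m r N : ℕ} (hrm : r ≤ m) (hn : n ≤ h r)
    (c : Fin r → ℕ) (hc : ∀ i, 1 ≤ c i ∧ c i ≤ n) (hN : r * m < N) :
    WTpoly (ladder m n h) (fun i : Fin r => ((i : ℕ) + 1, n)) (fun i : Fin r => (m, c i)) N =
      FT X h n m c := by
  classical
  have e : FT (X : ℚ[X]) h n m c =
      ∑ C ∈ (Fintype.piFinset (fun i : Fin r => P h n m ((i : ℕ) + 1) (c i))).filter Dj,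
        X ^ (∑ i, cornersCount (C i)) := by
    rw [FT, Finset.sum_filter]
    refine Finset.sum_congr rfl fun C _ => ?_
    unfold Fs ind
    split_ifs <;> simp
  rw [e, ← ncard_sum _ (fun C : Fin r → Finset (ℕ × ℕ) => ∑ i, cornersCount (C i)) N]
  · simp only [WTpoly, tupleCount, Finset.mem_filter, Fintype.mem_piFinset, mem_P, and_assoc]
  · intro C hC
    rw [Finset.mem_filter, Fintype.mem_piFinset] at hC
    refine lt_of_le_of_lt ?_ hN
    calc ∑ i, cornersCount (C i) ≤ ∑ _i : Fin r, m := by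
          refine Finset.sum_le_sum fun i _ => ?_
          have hi := i.2
          have h3 := hC.1 i
          obtain ⟨k, hk⟩ := Nat.exists_eq_add_of_le (show (i : ℕ) + 1 ≤ m by omega)
          have := corners_le hanti (n := n) (a := (i : ℕ) + 1) (by omega)
            (hn.trans (hanti (by omega))) k (c i) (C i) (hc i).1 (hc i).2 (by rw [← hk]; exact h3)
          omega
      _ = r * m := by simp

theorem link_aux (n l : ℕ) (b c : Fin l → ℕ) (A : (Fin l → ℕ) → ℕ) (t : ℚ[X])
    (hc : ∀ i, c i ≤ n)
    (hA : ∀ e ∈ S l n, (A e : ℚ[X]) * (1 - t) ^ (∑ i, (e i - b i)) = Aq t n l b e)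
    (hA0 : ∀ e, A e ≠ 0 → ∀ i, b i ≤ e i) :
    ((∑ e ∈ (Finset.Icc (fun _ => 1) c).filter (fun e => ∀ i j : Fin l, i < j → e i < e j),
      A e : ℕ) : ℚ[X]) * (1 - t) ^ (∑ i, (c i - b i)) = Bq t n l b c := by
  rw [Bq, ← Finset.sum_subset (s₂ := S l n)
    (s₁ := (Finset.Icc (fun _ => 1) c).filter (fun e => ∀ i j : Fin l, i < j → e i < e j))]
  · rw [Nat.cast_sum, Finset.sum_mul]
    refine Finset.sum_congr rfl fun e he => ?_
    rw [Finset.mem_filter, Finset.mem_Icc] at he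
    obtain ⟨⟨h1, h2⟩, h3⟩ := he
    rw [← hA e (mem_S.2 ⟨fun i => ⟨h1 i, (h2 i).trans (hc i)⟩, h3⟩)]
    by_cases h0 : A e = 0
    · simp [h0]
    have hbe := hA0 e h0
    have : ∏ i, u t (e i) (c i) = (1 - t) ^ (∑ i, (c i - e i)) := by
      rw [← Finset.prod_pow_eq_pow_sum]
      refine Finset.prod_congr rfl fun i _ => ?_
      rw [u, if_pos (h2 i)]
    rw [this, mul_assoc, ← pow_add, ← Finset.sum_add_distrib]
    congr 3
    funext i
    have := hbe i
    have : e i ≤ c i := h2 i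
    omega
  · intro e he
    rw [Finset.mem_filter, Finset.mem_Icc] at he
    obtain ⟨⟨h1, h2⟩, h3⟩ := he
    exact mem_S.2 ⟨fun i => ⟨h1 i, (h2 i).trans (hc i)⟩, h3⟩
  · intro e he hne
    by_contra h0
    apply hne
    rw [mem_S] at he
    rw [Finset.mem_filter, Finset.mem_Icc]
    refine ⟨⟨fun i => (he.1 i).1, fun i => ?_⟩, he.2⟩
    exact u_ne (Finset.prod_ne_zero_iff.1 (right_ne_zero_of_mul h0) i (Finset.mem_univ i))

theorem Acoef_le : ∀ (l : ℕ) (b c : Fin (l + 2) → ℕ), Acoef (l + 2) b c ≠ 0 → ∀ i, b i ≤ c i := by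
  intro l
  induction l with
  | zero =>
    intro b c h0 i
    rw [Acoef] at h0
    split_ifs at h0 with h1
    · fin_cases i
      · exact h1.2
      · exact h1.1.le
    · exact absurd rfl h0
  | succ l ih =>
    intro b c h0 i
    rw [Acoef] at h0
    split_ifs at h0 with h1
    · obtain ⟨e, he, he0⟩ := Finset.exists_ne_zero_of_sum_ne_zero h0
      rw [Finset.mem_filter, Finset.mem_Icc] at he
      refine Fin.lastCases h1.le (fun i => ?_) i
      exact (ih _ e he0 i).trans (he.1.2 i)
    · exact absurd rfl h0

theorem link (n : ℕ) (t : ℚ[X]) : ∀ (l : ℕ) (b c : Fin (l + 2) → ℕ), (∀ i, 1 ≤ b i) →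
    (∀ i, c i ≤ n) →
    (Acoef (l + 2) b c : ℚ[X]) * (1 - t) ^ (∑ i, (c i - b i)) = Aq t n (l + 2) b c := by
  intro l
  induction l with
  | zero =>
    intro b c hb hc
    rw [Aq_succ, Acoef]
    by_cases h1 : b 1 = c 1
    · rw [if_pos (show b (Fin.last 1) = c (Fin.last 1) from h1),
        ← link_aux n 1 (ini b) (ini c) (fun e => if b 0 = e 0 then 1 else 0) t (fun i => hc _)]
      · have e1 : ∑ i : Fin 2, (c i - b i) = c 0 - b 0 := by
          rw [Fin.sum_univ_two, h1]; omega
        rw [e1]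
        have e2 : ∑ i : Fin 1, (ini c i - ini b i) = c 0 - b 0 := by simp [ini]
        rw [e2]
        congr 2
        by_cases h2 : b 0 ≤ c 0
        · rw [if_pos ⟨h1, h2⟩, Finset.sum_eq_single (fun _ => b 0)]
          · simp
          · intro e _ hne
            rw [if_neg]
            intro h3
            apply hne
            funext i
            rw [Subsingleton.elim i 0, h3]
          · intro hne
            exfalso
            apply hne
            rw [Finset.mem_filter, Finset.mem_Icc]
            refine ⟨⟨fun i => hb 0, fun i => ?_⟩, fun i j hij => ?_⟩
            · rw [Subsingleton.elim i 0]; exact h2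
            · rw [Subsingleton.elim i j] at hij; exact absurd hij (lt_irrefl _)
        · rw [if_neg (fun h => h2 h.2)]
          symm
          refine Finset.sum_eq_zero fun e he => ?_
          rw [Finset.mem_filter, Finset.mem_Icc] at he
          rw [if_neg]
          intro h3
          have := he.1.2 0
          apply h2
          rw [h3]; exact this
      · intro e he
        rw [Aq_succ]
        have hS : S 0 n = {Fin.elim0} := by
          ext x
          rw [mem_S, Finset.mem_singleton]
          exact ⟨fun _ => Subsingleton.elim _ _, fun _ => ⟨fun i => i.elim0, fun i => i.elim0⟩⟩
        by_cases h3 : b 0 = e 0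
        · rw [if_pos (show ini b (Fin.last 0) = e (Fin.last 0) from h3), if_pos h3, Bq, hS]
          simp [Aq, h3]
        · rw [if_neg (show ¬ ini b (Fin.last 0) = e (Fin.last 0) from h3), if_neg h3]
          simp
      · intro e he i
        by_cases h3 : b 0 = e 0
        · rw [Subsingleton.elim i 0]; exact h3.le
        · rw [if_neg h3] at he; exact absurd rfl he
    · rw [if_neg (fun h => h1 h.1), if_neg (show ¬ b (Fin.last 1) = c (Fin.last 1) from h1)]
      simp
  | succ l ih =>
    intro b c hb hc
    rw [Aq_succ, Acoef]
    by_cases h1 : b (Fin.last (l + 2)) = c (Fin.last (l + 2))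
    · rw [if_pos h1, if_pos h1, ← link_aux n (l + 2) (ini b) (ini c)
        (fun e => Acoef (l + 2) (ini b) e) t (fun i => hc _)]
      · rw [Fin.sum_univ_castSucc (n := l + 2), h1, Nat.sub_self, add_zero]
        rfl
      · intro e he
        exact ih _ e (fun i => hb _) (fun i => ((mem_S.1 he).1 i).2)
      · intro e he
        exact Acoef_le l _ e he
    · rw [if_neg h1, if_neg h1]
      simp

end CH

/-- Theorem 4.2 (main theorem, generalizing the Conca–Herzog conjecture): in a one-sided
ladder region `Y` with height function `h`, with `Pᵢ = (i,n)` and `Qᵢ = (m, bᵢ)` for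
`b₁ < ⋯ < b_r` points of `Y`,
`det[W(Pᵢ,Q_j)] = t^{C(r,2)} · ∑_{c ∈ S_r} A(b;c) (1-t)^{∑(cᵢ-bᵢ)} W(n,m; c₁,…,c_r)`.
(All terms with some `cᵢ > n` vanish since then `A(b;c) = 0`, as `A` forces `c_r = b_r ≤ n`
and `c` is increasing; so the finite sum below is the full sum over `S_r`.) -/
theorem main_theorem (m n r : ℕ) (h : ℕ → ℕ) (hanti : Antitone h) (h1 : h 1 = n)
    (hr : 2 ≤ r) (hrm : r ≤ m) (hrn : r ≤ n)
    (b : Fin r → ℕ) (hb : StrictMono b) (hb1 : ∀ i, 1 ≤ b i)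
    (hP : n ≤ h r) (hQ : ∀ i, b i ≤ h m) :
    Matrix.det (Matrix.of fun i j : Fin r =>
        Wpoly (ladder m n h) ((i : ℕ) + 1, n) (m, b j) (m + n + 1)) =
      X ^ r.choose 2 *
        ∑ c ∈ (Finset.Icc (fun _ => 1) (fun _ => n)).filter
            (fun c : Fin r → ℕ => ∀ i j, i < j → c i < c j),
          (Acoef r b c : Polynomial ℚ) * (1 - X) ^ (∑ i, (c i - b i)) *
            WTpoly (ladder m n h) (fun i : Fin r => ((i : ℕ) + 1, n))
              (fun i : Fin r => (m, c i)) (r * (m + n) + 1) := by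
  have hbn : ∀ i, b i ≤ n := fun i => by
    have := hQ i
    have := hanti (show 1 ≤ m by omega)
    omega
  have hS : (Finset.Icc (fun _ => 1) (fun _ => n)).filter
      (fun c : Fin r → ℕ => ∀ i j, i < j → c i < c j) = CH.S r n := by
    ext c
    rw [Finset.mem_filter, Finset.mem_Icc, CH.mem_S]
    constructor
    · rintro ⟨⟨h1, h2⟩, h3⟩
      exact ⟨fun i => ⟨h1 i, h2 i⟩, h3⟩
    · rintro ⟨h1, h3⟩
      exact ⟨⟨fun i => (h1 i).1, fun i => (h1 i).2⟩, h3⟩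
  have hdet : (Matrix.of fun i j : Fin r =>
      Wpoly (ladder m n h) ((i : ℕ) + 1, n) (m, b j) (m + n + 1)) =
      Matrix.of fun i j : Fin r => CH.Wp (X : ℚ[X]) h n m ((i : ℕ) + 1) (b j) := by
    ext1 i j
    simp only [Matrix.of_apply]
    have hi := i.2
    exact CH.Wpoly_eq hanti (by omega) (by omega) (hP.trans (hanti (by omega))) (hb1 j) (hbn j)
      (by omega)
  rw [hdet, hS]
  have hsum : ∀ c ∈ CH.S r n, (Acoef r b c : Polynomial ℚ) * (1 - X) ^ (∑ i, (c i - b i)) *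
      WTpoly (ladder m n h) (fun i : Fin r => ((i : ℕ) + 1, n))
        (fun i : Fin r => (m, c i)) (r * (m + n) + 1) =
      CH.Aq X n r b c * CH.FT X h n m c := by
    intro c hc
    rw [CH.mem_S] at hc
    rw [CH.WTpoly_eq hanti hrm hP c hc.1 (by rw [Nat.mul_add]; omega)]
    obtain ⟨l, rfl⟩ : ∃ l, r = l + 2 := ⟨r - 2, by omega⟩
    rw [CH.link n X l b c hb1 (fun i => (hc.1 i).2)]
  rw [Finset.sum_congr rfl hsum]
  obtain ⟨r, rfl⟩ : ∃ l, r = l + 1 := ⟨r - 1, by omega⟩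
  obtain ⟨k, rfl⟩ := Nat.exists_eq_add_of_le hrm
  exact CH.main_alg X hanti hP k b (CH.mem_S.2 ⟨fun i => ⟨hb1 i, hbn i⟩, fun i j hij => hb hij⟩) hQ
end
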